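/- Let X be a graph-directed Bedford–McMullen (×m,×n)-carpet whose underlying directed graph G is irreducible. Then dim_A X = h_top(πI)/log m + sup_{y∈πI} h_top(π^{-1}(y))/log n. -/

import Mathlib

open Set Filter Topology Metric
open scoped Classical

noncomputable section

/-- Least cardinality of a finite set of centers of closed balls of radius `r` covering `E`. -/
def coverNum {X : Type*} [PseudoMetricSpace X] (r : ℝ) (E : Set X) : ℕ :=
  sInf {k : ℕ | ∃ S : Finset X, S.card = k ∧ E ⊆ ⋃ x ∈ S, Metric.closedBall x r}

/-- Upper box (Minkowski) dimension. -/
def upperBoxDim {X : Type*} [PseudoMetricSpace X] (E : Set X) : ℝ :=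
  limsup (fun r : ℝ => Real.log (coverNum r E) / Real.log (1 / r)) (𝓝[>] (0 : ℝ))

/-- Lower box (Minkowski) dimension. -/
def lowerBoxDim {X : Type*} [PseudoMetricSpace X] (E : Set X) : ℝ :=
  liminf (fun r : ℝ => Real.log (coverNum r E) / Real.log (1 / r)) (𝓝[>] (0 : ℝ))

/-- The box dimension (well-defined when `lowerBoxDim E = upperBoxDim E`). -/
def boxDim {X : Type*} [PseudoMetricSpace X] (E : Set X) : ℝ := upperBoxDim E

/-- Assouad dimension. -/
def assouadDim {X : Type*} [PseudoMetricSpace X] (E : Set X) : ℝ :=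
  sInf {s : ℝ | 0 ≤ s ∧ ∃ C : ℝ, 0 < C ∧ ∀ x ∈ E, ∀ r R : ℝ,
    0 < r → r < R → R ≤ 1 →
    (coverNum r (E ∩ Metric.ball x R) : ℝ) ≤ C * (R / r) ^ s}

/-- Lower dimension. -/
def lowerDim {X : Type*} [PseudoMetricSpace X] (E : Set X) : ℝ :=
  sSup {s : ℝ | 0 ≤ s ∧ ∃ C : ℝ, 0 < C ∧ ∀ x ∈ E, ∀ r R : ℝ,
    0 < r → r < R → R ≤ 1 →
    C * (R / r) ^ s ≤ (coverNum r (E ∩ Metric.ball x R) : ℝ)}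

/-- A graph-directed Bedford–McMullen `(×m,×n)`-carpet family: a finite directed graph
`(V, E)` (loops and multiple edges allowed) in which every vertex emits an edge, each edge
carrying a digit pair `(x_e, y_e) ∈ {0,…,n−1} × {0,…,m−1}`, together with the unique family
of nonempty compact attractors `X v ⊆ [0,1]²` satisfying
`X v = ⋃_{e : src e = v} ψ_e (X (tgt e))` where `ψ_e (ξ₁, ξ₂) = ((ξ₁+x_e)/n, (ξ₂+y_e)/m)`. -/
structure GDBMCarpet where
  m : ℕ
  n : ℕ
  hm : 2 ≤ m
  hmn : m < n
  V : Type
  E : Type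
  fintypeV : Fintype V
  fintypeE : Fintype E
  decV : DecidableEq V
  decE : DecidableEq E
  src : E → V
  tgt : E → V
  xd : E → Fin n
  yd : E → Fin m
  src_surj : ∀ v : V, ∃ e : E, src e = v
  X : V → Set (ℝ × ℝ)
  X_nonempty : ∀ v, (X v).Nonempty
  X_compact : ∀ v, IsCompact (X v)
  X_subset : ∀ v, X v ⊆ Set.Icc (0 : ℝ) 1 ×ˢ Set.Icc (0 : ℝ) 1
  X_invariant : ∀ v, X v =
    ⋃ e ∈ {e : E | src e = v},
      (fun p : ℝ × ℝ => ((p.1 + (xd e : ℝ)) / n, (p.2 + (yd e : ℝ)) / m)) '' X (tgt e)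

attribute [instance] GDBMCarpet.fintypeV GDBMCarpet.fintypeE GDBMCarpet.decV GDBMCarpet.decE

namespace GDBMCarpet

variable (S : GDBMCarpet)

/-- The contraction `ψ_e`. -/
def psi (e : S.E) : ℝ × ℝ → ℝ × ℝ :=
  fun p => ((p.1 + (S.xd e : ℝ)) / S.n, (p.2 + (S.yd e : ℝ)) / S.m)

/-- The projected contraction `φ_e` on the second coordinate axis. -/
def phi (e : S.E) : ℝ → ℝ := fun t => (t + (S.yd e : ℝ)) / S.m

/-- The carpet `X = ⋃_{v ∈ V} X_v`. -/
def Xunion : Set (ℝ × ℝ) := ⋃ v : S.V, S.X v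

/-- The projection `π(ξ₁,ξ₂) = ξ₂` onto the second coordinate axis. -/
def proj : ℝ × ℝ → ℝ := Prod.snd

/-- The open unit square `(0,1)²`. -/
def openSquare : Set (ℝ × ℝ) := Set.Ioo (0 : ℝ) 1 ×ˢ Set.Ioo (0 : ℝ) 1

/-- `w : Fin k → E` is an admissible word along the graph. -/
def IsWord (k : ℕ) (w : Fin k → S.E) : Prop :=
  ∀ (i : ℕ) (h : i + 1 < k), S.tgt (w ⟨i, Nat.lt_of_succ_lt h⟩) = S.src (w ⟨i + 1, h⟩)

/-- The word `w` has initial vertex `v` (vacuous for the empty word). -/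
def wordStart (k : ℕ) (w : Fin k → S.E) (v : S.V) : Prop :=
  ∀ h : 0 < k, S.src (w ⟨0, h⟩) = v

/-- The terminal vertex `t(w)` of a nonempty word. -/
def wordEnd {k : ℕ} (hk : 0 < k) (w : Fin k → S.E) : S.V :=
  S.tgt (w ⟨k - 1, Nat.sub_lt hk one_pos⟩)

/-- `ψ_w = ψ_{w₁} ∘ ⋯ ∘ ψ_{w_k}`. -/
def psiWord (k : ℕ) (w : Fin k → S.E) : ℝ × ℝ → ℝ × ℝ :=
  (List.ofFn (fun i => S.psi (w i))).foldr (· ∘ ·) id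

/-- `φ_w = φ_{w₁} ∘ ⋯ ∘ φ_{w_k}`. -/
def phiWord (k : ℕ) (w : Fin k → S.E) : ℝ → ℝ :=
  (List.ofFn (fun i => S.phi (w i))).foldr (· ∘ ·) id

/-- `η(v,x,y) = dim_B π(X_v ∩ ψ_w((0,1)²))` if some admissible word `w` with `i(w) = v`
has digit strings `(x, y)`, and `0` otherwise.  (The set `ψ_w((0,1)²)` depends only on the
digit strings, so the choice of witness is immaterial.) -/
def eta (v : S.V) (k : ℕ) (x : Fin k → Fin S.n) (y : Fin k → Fin S.m) : ℝ :=
  if h : ∃ w : Fin k → S.E, S.IsWord k w ∧ S.wordStart k w v ∧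
      (∀ i, S.xd (w i) = x i) ∧ (∀ i, S.yd (w i) = y i) then
    boxDim (GDBMCarpet.proj '' (S.X v ∩ S.psiWord k h.choose '' GDBMCarpet.openSquare))
  else 0

/-- The open interval `I_{y'}` associated with a finite word `y'` over `Σ_Y`. -/
def Iy (l : ℕ) (y : Fin l → Fin S.m) : Set ℝ :=
  Set.Ioo (∑ i : Fin l, (y i : ℝ) / (S.m : ℝ) ^ ((i : ℕ) + 1))
    ((∑ i : Fin l, (y i : ℝ) / (S.m : ℝ) ^ ((i : ℕ) + 1)) + 1 / (S.m : ℝ) ^ l)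

/-- `θ(v, x, y, y')`:  equals `η(v,x,y)` when `y' = ∅`, and equals
`dim_B (π(X_v ∩ ψ_w((0,1)²)) ∩ φ_w(I_{y'}))` when `y' ≠ ∅` (with `0` when no witness
word exists). -/
def theta (v : S.V) (k : ℕ) (x : Fin k → Fin S.n) (y : Fin k → Fin S.m)
    (l : ℕ) (y' : Fin l → Fin S.m) : ℝ :=
  if l = 0 then S.eta v k x y
  else if h : ∃ w : Fin k → S.E, S.IsWord k w ∧ S.wordStart k w v ∧
      (∀ i, S.xd (w i) = x i) ∧ (∀ i, S.yd (w i) = y i) then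
    boxDim ((GDBMCarpet.proj '' (S.X v ∩ S.psiWord k h.choose '' GDBMCarpet.openSquare)) ∩
      S.phiWord k h.choose '' S.Iy l y')
  else 0

/-- `Ṽ`: vertices that are terminal vertices of admissible words of length at least `#V`. -/
def Vtilde : Set S.V :=
  {v | ∃ (k : ℕ) (hk : 0 < k), Fintype.card S.V ≤ k ∧
    ∃ w : Fin k → S.E, S.IsWord k w ∧ S.wordEnd hk w = v}

/-- The `x`-digit strings realized by admissible words of length `k` starting from `v`
with `y`-digit string `y`; these index the equivalence classes `[w] ∈ [E^k]` with
`i(w) = v` and `y_w = y` (a class is determined by its digit strings). -/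
def realizedX (v : S.V) (k : ℕ) (y : Fin k → Fin S.m) : Finset (Fin k → Fin S.n) :=
  Finset.univ.filter (fun x => ∃ w : Fin k → S.E, S.IsWord k w ∧ S.wordStart k w v ∧
    (∀ i, S.xd (w i) = x i) ∧ (∀ i, S.yd (w i) = y i))

/-- The digit-string pairs realized by admissible words of length `k` from `v`; these
index the classes `[w]` with `w ∈ E^k`, `i(w) = v`. -/
def realizedXY (v : S.V) (k : ℕ) : Finset ((Fin k → Fin S.n) × (Fin k → Fin S.m)) :=
  Finset.univ.filter (fun xy => ∃ w : Fin k → S.E, S.IsWord k w ∧ S.wordStart k w v ∧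
    (∀ i, S.xd (w i) = xy.1 i) ∧ (∀ i, S.yd (w i) = xy.2 i))

/-- `α_k = max_{v∈Ṽ} max_{y∈Σ_Y^k} Σ_{[w]∈[E^k] : i(w)=v, y_w=y} n^{k·η(v,x_w,y_w)}`. -/
def alphaSeq (k : ℕ) : ℝ :=
  ⨆ v ∈ S.Vtilde, ⨆ y : Fin k → Fin S.m,
    ∑ x ∈ S.realizedX v k y, (S.n : ℝ) ^ ((k : ℝ) * S.eta v k x y)

/-- `τ_k = max_{v ∈ V} #{[w] : w ∈ E^k, i(w) = v}`. -/
def tauSeq (k : ℕ) : ℕ :=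
  Finset.univ.sup (fun v : S.V => (S.realizedXY v k).card)

/-- `t([w])`: the set of terminal vertices of words equivalent to `w` (words with the
same digit strings). -/
def termSet (k : ℕ) (hk : 0 < k) (w : Fin k → S.E) : Set S.V :=
  {v | ∃ w' : Fin k → S.E, S.IsWord k w' ∧ (∀ i, S.xd (w' i) = S.xd (w i)) ∧
    (∀ i, S.yd (w' i) = S.yd (w i)) ∧ S.wordEnd hk w' = v}

/-- The inner collection in the definition of `β_k`. -/
def betaInner (v : S.V) (k : ℕ) : Set ℝ :=
  {c | ∃ (y : Fin k → Fin S.m) (l : ℕ) (y' : Fin l → Fin S.m),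
    (0 < ∑ x ∈ S.realizedX v k y, S.theta v k x y l y') ∧
    c = ∑ x ∈ S.realizedX v k y,
      (if 0 < S.theta v k x y l y' then (S.n : ℝ) ^ ((k : ℝ) * S.theta v k x y l y') else 0)}

/-- `β_k`. -/
def betaSeq (k : ℕ) : ℝ :=
  sInf {b | ∃ (l : ℕ) (hl : 0 < l) (w : Fin l → S.E),
    Fintype.card S.V ≤ l ∧ S.IsWord l w ∧
    b = ⨆ v ∈ S.termSet l hl w, sInf (S.betaInner v k)}

/-- `β = liminf_{k→∞} (β_k)^{1/k}`. -/
def betaVal : ℝ := liminf (fun k : ℕ => (S.betaSeq k) ^ ((k : ℝ)⁻¹)) atTop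

/-- `l = ⌊k·log_n m⌋`, so that `n^l ≤ m^k < n^{l+1}`. -/
def lvl (k : ℕ) : ℕ := Nat.floor ((k : ℝ) * Real.logb S.n S.m)

/-- The approximate square `Q_k(p,q) = [p/n^l, (p+1)/n^l] × [q/m^k, (q+1)/m^k]`. -/
def approxSq (k : ℕ) (p q : ℤ) : Set (ℝ × ℝ) :=
  Set.Icc ((p : ℝ) / (S.n : ℝ) ^ S.lvl k) (((p : ℝ) + 1) / (S.n : ℝ) ^ S.lvl k) ×ˢ
  Set.Icc ((q : ℝ) / (S.m : ℝ) ^ k) (((q : ℝ) + 1) / (S.m : ℝ) ^ k)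

/-- `N_k(F)` for `F ⊆ ℝ²`: least number of level-`k` approximate squares covering `F`. -/
def NkSq (k : ℕ) (F : Set (ℝ × ℝ)) : ℕ :=
  sInf {c : ℕ | ∃ T : Finset (ℤ × ℤ), T.card = c ∧ F ⊆ ⋃ pq ∈ T, S.approxSq k pq.1 pq.2}

/-- `N_k(F)` for `F ⊆ ℝ`: least number of intervals `[i/m^k, (i+1)/m^k]` covering `F`. -/
def NkInt (k : ℕ) (F : Set ℝ) : ℕ :=
  sInf {c : ℕ | ∃ T : Finset ℤ, T.card = c ∧
    F ⊆ ⋃ i ∈ T, Set.Icc ((i : ℝ) / (S.m : ℝ) ^ k) (((i : ℝ) + 1) / (S.m : ℝ) ^ k)}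

/-- The adjacency matrix `A` of `G`. -/
def adjMat : Matrix S.V S.V ℕ :=
  fun v v' => (Finset.univ.filter (fun e : S.E => S.src e = v ∧ S.tgt e = v')).card

/-- The matrices `A_j`, `0 ≤ j < m`, with `A_j(v,v') = #{e : v →e v', y_e = j}` (real
entries). -/
def Amat (j : Fin S.m) : Matrix S.V S.V ℝ :=
  fun v v' =>
    ((Finset.univ.filter (fun e : S.E => S.src e = v ∧ S.tgt e = v' ∧ S.yd e = j)).card : ℝ)

/-- `G` is irreducible: `Σ_{j ≥ 1} A^j` is positive. -/
def GraphIrreducible : Prop :=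
  ∀ v v' : S.V, ∃ k : ℕ, 0 < k ∧ 0 < (S.adjMat ^ k) v v'

/-- The rectangular open set condition. -/
def ROSC : Prop :=
  ∀ v : S.V, (∀ e : S.E, S.src e = v → S.psi e '' GDBMCarpet.openSquare ⊆ GDBMCarpet.openSquare) ∧
    ∀ e e' : S.E, S.src e = v → S.src e' = v → e ≠ e' →
      Disjoint (S.psi e '' GDBMCarpet.openSquare) (S.psi e' '' GDBMCarpet.openSquare)

/-- The words `I^k` of length `k` appearing in the symbolic space `I ⊆ (Σ_X × Σ_Y)^ℕ`. -/
def Ik (k : ℕ) : Finset (Fin k → Fin S.n × Fin S.m) :=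
  Finset.univ.filter (fun f => ∃ w : Fin k → S.E, S.IsWord k w ∧
    ∀ i, (S.xd (w i), S.yd (w i)) = f i)

/-- The words `(πI)^k` of length `k` appearing in `πI ⊆ Σ_Y^ℕ`. -/
def piIk (k : ℕ) : Finset (Fin k → Fin S.m) :=
  Finset.univ.filter (fun y => ∃ w : Fin k → S.E, S.IsWord k w ∧ ∀ i, S.yd (w i) = y i)

/-- `h_top(I) = lim_k (1/k) log #I^k`. -/
def hTopI : ℝ := limsup (fun k : ℕ => Real.log (S.Ik k).card / (k : ℝ)) atTop

/-- `h_top(πI) = lim_k (1/k) log #(πI)^k`. -/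
def hTopPiI : ℝ := limsup (fun k : ℕ => Real.log (S.piIk k).card / (k : ℝ)) atTop

/-- The symbolic projection space `πI ⊆ Σ_Y^ℕ`. -/
def piI : Set (ℕ → Fin S.m) :=
  {y | ∃ ω : ℕ → S.E, (∀ i, S.tgt (ω i) = S.src (ω (i + 1))) ∧ ∀ i, S.yd (ω i) = y i}

/-- The `x`-strings of length-`k` words lying over `y|_k`. -/
def fiberXk (y : ℕ → Fin S.m) (k : ℕ) : Finset (Fin k → Fin S.n) :=
  Finset.univ.filter (fun x => ∃ w : Fin k → S.E, S.IsWord k w ∧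
    (∀ i : Fin k, S.yd (w i) = y (i : ℕ)) ∧ ∀ i, S.xd (w i) = x i)

/-- `h_top(π⁻¹(y)) = limsup_k (1/k) log #{x_w : w ∈ E^k, y_w = y|_k}`. -/
def hTopFiber (y : ℕ → Fin S.m) : ℝ :=
  limsup (fun k : ℕ => Real.log (S.fiberXk y k).card / (k : ℝ)) atTop

/-- Words staying within the subgraph spanned by the vertex set `W`. -/
def InWord (W : Set S.V) (k : ℕ) (w : Fin k → S.E) : Prop :=
  S.IsWord k w ∧ ∀ i, S.src (w i) ∈ W ∧ S.tgt (w i) ∈ W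

/-- There is a directed path inside `W` from `v` to `v'`. -/
def PathIn (W : Set S.V) (v v' : S.V) : Prop :=
  ∃ (k : ℕ) (hk : 0 < k) (w : Fin k → S.E), S.InWord W k w ∧
    S.src (w ⟨0, hk⟩) = v ∧ S.wordEnd hk w = v'

/-- The subgraph spanned by `W` is irreducible. -/
def IsIrred (W : Set S.V) : Prop :=
  W.Nonempty ∧ ∀ v ∈ W, ∀ v' ∈ W, S.PathIn W v v'

/-- `W` spans an irreducible component of `G` (a maximal irreducible subgraph). -/
def IsIrredComponent (W : Set S.V) : Prop :=
  S.IsIrred W ∧ ∀ W' : Set S.V, W ⊆ W' → S.IsIrred W' → W' = W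

/-- There is a directed path in `G` from a vertex of `W` to a vertex of `W'`
(defining `{i}⁺`). -/
def Reaches (W W' : Set S.V) : Prop :=
  ∃ v ∈ W, ∃ v' ∈ W', S.PathIn Set.univ v v'

/-- `(I_H)^k` for the subgraph spanned by `W`. -/
def IkIn (W : Set S.V) (k : ℕ) : Finset (Fin k → Fin S.n × Fin S.m) :=
  Finset.univ.filter (fun f => ∃ w : Fin k → S.E, S.InWord W k w ∧
    ∀ i, (S.xd (w i), S.yd (w i)) = f i)

/-- `(πI_H)^k` for the subgraph spanned by `W`. -/
def piIkIn (W : Set S.V) (k : ℕ) : Finset (Fin k → Fin S.m) :=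
  Finset.univ.filter (fun y => ∃ w : Fin k → S.E, S.InWord W k w ∧ ∀ i, S.yd (w i) = y i)

/-- `h_top(I_H)`. -/
def hTopIIn (W : Set S.V) : ℝ :=
  limsup (fun k : ℕ => Real.log (S.IkIn W k).card / (k : ℝ)) atTop

/-- `h_top(πI_H)`. -/
def hTopPiIIn (W : Set S.V) : ℝ :=
  limsup (fun k : ℕ => Real.log (S.piIkIn W k).card / (k : ℝ)) atTop

/-- `πI_H` for the subgraph spanned by `W`. -/
def piIIn (W : Set S.V) : Set (ℕ → Fin S.m) :=
  {y | ∃ ω : ℕ → S.E, (∀ i, S.tgt (ω i) = S.src (ω (i + 1))) ∧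
    (∀ i, S.src (ω i) ∈ W ∧ S.tgt (ω i) ∈ W) ∧ ∀ i, S.yd (ω i) = y i}

/-- The `x`-strings of length-`k` words of the subgraph spanned by `W` lying over `y|_k`. -/
def fiberXkIn (W : Set S.V) (y : ℕ → Fin S.m) (k : ℕ) : Finset (Fin k → Fin S.n) :=
  Finset.univ.filter (fun x => ∃ w : Fin k → S.E, S.InWord W k w ∧
    (∀ i : Fin k, S.yd (w i) = y (i : ℕ)) ∧ ∀ i, S.xd (w i) = x i)

/-- `h_top(π⁻¹(y) ∩ I_H)`. -/
def hTopFiberIn (W : Set S.V) (y : ℕ → Fin S.m) : ℝ :=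
  limsup (fun k : ℕ => Real.log (S.fiberXkIn W y k).card / (k : ℝ)) atTop

end GDBMCarpet


namespace GDBMCarpet

/-- The value of the first `a` digits of `d` in base `b`. -/
def digitVal (b : ℕ) (d : ℕ → ℕ) : ℕ → ℕ
  | 0 => 0
  | a + 1 => b * digitVal b d a + d a

theorem digitVal_congr {b : ℕ} {d d' : ℕ → ℕ} {a : ℕ} (h : ∀ i < a, d i = d' i) :
    digitVal b d a = digitVal b d' a := by
  induction a with
  | zero => rfl
  | succ a ih =>
    simp only [digitVal]
    rw [ih fun i hi => h i (by omega), h a (by omega)]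

theorem eq_of_digitVal_eq {b : ℕ} {d d' : ℕ → ℕ} (hd : ∀ i, d i < b) (hd' : ∀ i, d' i < b)
    {a : ℕ} (h : digitVal b d a = digitVal b d' a) : ∀ i < a, d i = d' i := by
  induction a with
  | zero => intro i hi; omega
  | succ a ih =>
    simp only [digitVal] at h
    have h0 : 0 < b := (Nat.zero_le _).trans_lt (hd 0)
    have h1 : d a = d' a := by
      have := congrArg (· % b) h
      simpa [Nat.mul_add_mod, Nat.mod_eq_of_lt (hd a), Nat.mod_eq_of_lt (hd' a)] using this
    have h2 : digitVal b d a = digitVal b d' a := by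
      rw [h1] at h
      exact Nat.eq_of_mul_eq_mul_left h0 (Nat.add_right_cancel h)
    intro i hi
    rcases Nat.lt_succ_iff_lt_or_eq.1 hi with hi | rfl
    · exact ih h2 i hi
    · exact h1

/-- `t` lies in the closed `b`-adic interval of length `b⁻ᵃ` with digits `d₀ ⋯ d_{a-1}`. -/
def InCell (b : ℕ) (d : ℕ → ℕ) (a : ℕ) (t : ℝ) : Prop :=
  0 ≤ t * (b : ℝ) ^ a - digitVal b d a ∧ t * (b : ℝ) ^ a - digitVal b d a ≤ 1

theorem InCell.abs_sub_corner_le {b : ℕ} {d : ℕ → ℕ} {a : ℕ} {t : ℝ} (hb : 0 < b)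
    (h : InCell b d a t) : |t - digitVal b d a / (b : ℝ) ^ a| ≤ 1 / (b : ℝ) ^ a := by
  have hp : (0 : ℝ) < (b : ℝ) ^ a := by positivity
  have : t - digitVal b d a / (b : ℝ) ^ a = (t * (b : ℝ) ^ a - digitVal b d a) / (b : ℝ) ^ a := by
    field_simp
  rw [this, abs_div, abs_of_pos hp, abs_of_nonneg h.1]
  gcongr
  exact h.2

theorem InCell.abs_sub_le {b : ℕ} {d d' : ℕ → ℕ} {a : ℕ} {t t' : ℝ} (hb : 0 < b)
    (h : InCell b d a t) (h' : InCell b d' a t') (hd : ∀ i < a, d i = d' i) :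
    |t - t'| ≤ 1 / (b : ℝ) ^ a := by
  have hp : (0 : ℝ) < (b : ℝ) ^ a := by positivity
  rw [InCell, ← digitVal_congr hd] at h'
  have : t - t' = ((t * (b : ℝ) ^ a - digitVal b d a) - (t' * (b : ℝ) ^ a - digitVal b d a))
      / (b : ℝ) ^ a := by
    field_simp
    ring
  rw [this, abs_div, abs_of_pos hp]
  gcongr
  rw [abs_le]
  constructor <;> linarith [h.1, h.2, h'.1, h'.2]

theorem InCell.mem_window {b : ℕ} {d : ℕ → ℕ} {a : ℕ} {t c ρ : ℝ} (h : InCell b d a t)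
    (hρ : ρ * (b : ℝ) ^ a ≤ 1) (ht : |t - c| ≤ ρ) :
    (digitVal b d a : ℤ) ∈
      Finset.Icc (⌊c * (b : ℝ) ^ a⌋ - 2) (⌊c * (b : ℝ) ^ a⌋ + 2) := by
  have hp : (0 : ℝ) ≤ (b : ℝ) ^ a := by positivity
  have h1 : |t * (b : ℝ) ^ a - c * (b : ℝ) ^ a| ≤ 1 := by
    rw [← sub_mul, abs_mul, abs_of_nonneg hp]
    exact (mul_le_mul_of_nonneg_right ht hp).trans hρ
  rw [abs_le] at h1
  have h2 := Int.floor_le (c * (b : ℝ) ^ a)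
  have h3 := Int.lt_floor_add_one (c * (b : ℝ) ^ a)
  rw [Finset.mem_Icc]
  constructor
  · have : ((⌊c * (b : ℝ) ^ a⌋ - 2 : ℤ) : ℝ) ≤ (digitVal b d a : ℤ) := by
      push_cast
      linarith [h.1, h.2, h1.1, h1.2]
    exact_mod_cast this
  · have : ((digitVal b d a : ℤ) : ℝ) < ((⌊c * (b : ℝ) ^ a⌋ + 2 + 1 : ℤ) : ℝ) := by
      push_cast
      linarith [h.1, h.2, h1.1, h1.2]
    exact Int.lt_add_one_iff.1 (by exact_mod_cast this)

theorem ncard_image_le_mul {α γ δ : Type*} [Finite γ] (g : α → γ) (f : α → δ) (s : Set α)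
    {M N : ℕ} (hfin : (f '' s).Finite) (hM : (f '' s).ncard ≤ M)
    (hN : ∀ d ∈ f '' s, (g '' {a ∈ s | f a = d}).ncard ≤ N) : (g '' s).ncard ≤ M * N := by
  have hsub : g '' s ⊆ ⋃ d ∈ hfin.toFinset, g '' {a ∈ s | f a = d} := by
    rintro _ ⟨a, ha, rfl⟩
    simp only [mem_iUnion]
    exact ⟨f a, hfin.mem_toFinset.2 ⟨a, ha, rfl⟩, a, ⟨ha, rfl⟩, rfl⟩
  calc (g '' s).ncard ≤ (⋃ d ∈ hfin.toFinset, g '' {a ∈ s | f a = d}).ncard :=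
        ncard_le_ncard hsub (toFinite _)
    _ ≤ ∑ d ∈ hfin.toFinset, (g '' {a ∈ s | f a = d}).ncard :=
        Finset.set_ncard_biUnion_le _ _
    _ ≤ ∑ d ∈ hfin.toFinset, N :=
        Finset.sum_le_sum fun d hd => hN d (hfin.mem_toFinset.1 hd)
    _ = (f '' s).ncard * N := by
        rw [Finset.sum_const, smul_eq_mul, ncard_eq_toFinset_card _ hfin]
    _ ≤ M * N := Nat.mul_le_mul_right _ hM

theorem ncard_image_le_of_eq {α γ δ : Type*} (g : α → γ) (f : α → δ) (s : Set α)
    (hfin : (f '' s).Finite) (h : ∀ a ∈ s, ∀ b ∈ s, f a = f b → g a = g b) :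
    (g '' s).Finite ∧ (g '' s).ncard ≤ (f '' s).ncard := by
  rcases s.eq_empty_or_nonempty with rfl | ⟨a₀, -⟩
  · simp
  have : Nonempty α := ⟨a₀⟩
  have hsub : g '' s ⊆ (fun d => g (Function.invFunOn f s d)) '' (f '' s) := by
    rintro _ ⟨a, ha, rfl⟩
    refine ⟨f a, ⟨a, ha, rfl⟩, ?_⟩
    exact h _ (Function.invFunOn_mem ⟨a, ha, rfl⟩) _ ha (Function.invFunOn_eq ⟨a, ha, rfl⟩)
  exact ⟨(hfin.image _).subset hsub,
    (ncard_le_ncard hsub (hfin.image _)).trans (ncard_image_le hfin)⟩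

variable {S : GDBMCarpet}

/-- The set `E^∞` of infinite admissible words. -/
def paths (S : GDBMCarpet) : Set (ℕ → S.E) :=
  {ω | ∀ i, S.tgt (ω i) = S.src (ω (i + 1))}

/-- The sequence following `u` for `a` steps and then `v`. -/
def splice {α : Type*} (a : ℕ) (u v : ℕ → α) : ℕ → α :=
  fun i => if i < a then u i else v (i - a)

theorem splice_of_lt {α : Type*} {a i : ℕ} {u v : ℕ → α} (h : i < a) :
    splice a u v i = u i := by
  simp [splice, h]

theorem splice_add {α : Type*} {a i : ℕ} {u v : ℕ → α} : splice a u v (a + i) = v i := by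
  simp [splice]

theorem splice_of_le {α : Type*} {a i : ℕ} {u v : ℕ → α} (h : a ≤ i) :
    splice a u v i = v (i - a) := by
  simp [splice, Nat.not_lt.2 h]

theorem splice_mem_paths {a : ℕ} {u v : ℕ → S.E} (hu : u ∈ S.paths) (hv : v ∈ S.paths)
    (h : S.src (u a) = S.src (v 0)) : splice a u v ∈ S.paths := by
  intro i
  rcases lt_trichotomy (i + 1) a with h1 | h1 | h1
  · rw [splice_of_lt h1, splice_of_lt (by omega)]
    exact hu i
  · rw [splice_of_lt (by omega), splice_of_le (by omega), hu i, h1, h, Nat.sub_self]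
  · rw [splice_of_le (by omega), splice_of_le (by omega), hv,
      show i + 1 - a = i - a + 1 by omega]

theorem src_splice_zero {a : ℕ} {u v : ℕ → S.E} (h : S.src (u a) = S.src (v 0)) :
    S.src (splice a u v 0) = S.src (u 0) := by
  rcases Nat.eq_zero_or_pos a with rfl | ha
  · rw [h, splice_of_le le_rfl]
  · rw [splice_of_lt ha]

theorem shift_mem_paths {ω : ℕ → S.E} (a : ℕ) (h : ω ∈ S.paths) :
    (fun i => ω (a + i)) ∈ S.paths := fun i => h (a + i)

theorem exists_path_from (v : S.V) : ∃ ω ∈ S.paths, S.src (ω 0) = v := by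
  choose out hout using S.src_surj
  refine ⟨fun i => (fun e => out (S.tgt e))^[i] (out v), fun i => ?_, hout v⟩
  simp only [Function.iterate_succ_apply', hout]

theorem exists_path_extending {k : ℕ} {w : Fin k → S.E} (hw : S.IsWord k w) [Nonempty S.V] :
    ∃ ω ∈ S.paths, ∀ i : Fin k, ω i = w i := by
  rcases k with _ | k
  · obtain ⟨ω, hω, -⟩ := exists_path_from (Classical.arbitrary S.V)
    exact ⟨ω, hω, fun i => i.elim0⟩
  · obtain ⟨ω, hω, h0⟩ := exists_path_from (S.tgt (w (Fin.last k)))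
    refine ⟨fun i => if h : i < k + 1 then w ⟨i, h⟩ else ω (i - (k + 1)), fun i => ?_,
      fun i => by simp [i.2]⟩
    rcases lt_trichotomy i k with h | rfl | h
    · simp only [dif_pos (show i < k + 1 by omega), dif_pos (show i + 1 < k + 1 by omega)]
      exact hw i (by omega)
    · simp [h0, Fin.last]
    · simp only [dif_neg (show ¬ i < k + 1 by omega), dif_neg (show ¬ i + 1 < k + 1 by omega)]
      rw [hω, show i + 1 - (k + 1) = i - (k + 1) + 1 by omega]

theorem isWord_of_mem_paths {ω : ℕ → S.E} (h : ω ∈ S.paths) (k : ℕ) :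
    S.IsWord k (fun i => ω i) := fun i _ => h i

theorem exists_path_of_adjMat_pow (k : ℕ) : ∀ v v' : S.V, 0 < (S.adjMat ^ k) v v' →
    ∃ ω ∈ S.paths, S.src (ω 0) = v ∧ S.src (ω k) = v' := by
  induction k with
  | zero =>
    intro v v' h
    obtain ⟨ω, hω, h0⟩ := exists_path_from v
    refine ⟨ω, hω, h0, ?_⟩
    by_cases hv : v = v'
    · rw [h0, hv]
    · simp [hv] at h
  | succ k ih =>
    intro v v' h
    rw [pow_succ', Matrix.mul_apply] at h
    obtain ⟨u, -, hu⟩ := Finset.exists_ne_zero_of_sum_ne_zero h.ne'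
    have h1 : 0 < S.adjMat v u := Nat.pos_of_ne_zero (left_ne_zero_of_mul hu)
    obtain ⟨ω, hω, h0, hk⟩ := ih u v' (Nat.pos_of_ne_zero (right_ne_zero_of_mul hu))
    obtain ⟨e, he⟩ := Finset.card_pos.1 h1
    simp only [Finset.mem_filter, Finset.mem_univ, true_and] at he
    refine ⟨fun i => Nat.casesOn i e ω, fun i => ?_, he.1, hk⟩
    rcases i with _ | i
    · exact he.2.trans h0.symm
    · exact hω i

theorem GraphIrreducible.exists_path (hirr : S.GraphIrreducible) (v v' : S.V) :
    ∃ c, 0 < c ∧ ∃ ω ∈ S.paths, S.src (ω 0) = v ∧ S.src (ω c) = v' := by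
  obtain ⟨k, hk, h⟩ := hirr v v'
  exact ⟨k, hk, exists_path_of_adjMat_pow k v v' h⟩

theorem GraphIrreducible.exists_bound (hirr : S.GraphIrreducible) :
    ∃ B, ∀ v v' : S.V, ∃ c, 0 < c ∧ c ≤ B ∧ ∃ ω ∈ S.paths, S.src (ω 0) = v ∧ S.src (ω c) = v' := by
  choose c hc h using hirr.exists_path
  refine ⟨Finset.univ.sup fun p : S.V × S.V => c p.1 p.2, fun v v' => ⟨c v v', hc v v', ?_, h v v'⟩⟩
  exact Finset.le_sup (f := fun p : S.V × S.V => c p.1 p.2) (Finset.mem_univ (v, v'))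

theorem GraphIrreducible.exists_path_to (hirr : S.GraphIrreducible) (L : ℕ) :
    ∀ v : S.V, ∃ ω ∈ S.paths, S.src (ω L) = v := by
  induction L with
  | zero => exact exists_path_from
  | succ L ih =>
    intro v
    obtain ⟨c, hc, ω, hω, -, hv⟩ := hirr.exists_path v v
    obtain ⟨ω', hω', h'⟩ := ih (S.src (ω (c - 1)))
    refine ⟨splice L ω' fun i => ω (c - 1 + i),
      splice_mem_paths hω' (shift_mem_paths _ hω) h', ?_⟩
    rw [splice_add]
    simpa [Nat.sub_add_cancel hc] using hv

/-- `z` lies in the closed box of the first `a` `x`-digits and first `b` `y`-digits of `ω`. -/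
def InBox (S : GDBMCarpet) (ω : ℕ → S.E) (a b : ℕ) (z : ℝ × ℝ) : Prop :=
  InCell S.n (fun i => S.xd (ω i)) a z.1 ∧ InCell S.m (fun i => S.yd (ω i)) b z.2

theorem n_pos (S : GDBMCarpet) : 0 < S.n := by have := S.hm; have := S.hmn; omega

theorem m_pos (S : GDBMCarpet) : 0 < S.m := by have := S.hm; omega

theorem mem_unitSquare {v : S.V} {z : ℝ × ℝ} (h : z ∈ S.X v) :
    (0 ≤ z.1 ∧ z.1 ≤ 1) ∧ (0 ≤ z.2 ∧ z.2 ≤ 1) := S.X_subset v h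

theorem mem_X_iff {v : S.V} {z : ℝ × ℝ} :
    z ∈ S.X v ↔ ∃ e, S.src e = v ∧ ∃ z' ∈ S.X (S.tgt e), S.psi e z' = z := by
  rw [S.X_invariant v]
  simp [psi]

theorem exists_path_coding {v : S.V} {z : ℝ × ℝ} (hz : z ∈ S.X v) :
    ∃ ω ∈ S.paths, ∀ a b, S.InBox ω a b z := by
  let T := {p : S.V × (ℝ × ℝ) // p.2 ∈ S.X p.1}
  have step (p : T) : ∃ e, S.src e = p.1.1 ∧ ∃ q : T, q.1.1 = S.tgt e ∧ S.psi e q.1.2 = p.1.2 := by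
    obtain ⟨e, he, z', hz', h⟩ := mem_X_iff.1 p.2
    exact ⟨e, he, ⟨⟨(S.tgt e, z'), hz'⟩, rfl, h⟩⟩
  choose e he q hq hpsi using step
  let p : ℕ → T := fun i => q^[i] ⟨(v, z), hz⟩
  have hp (i : ℕ) : p (i + 1) = q (p i) := Function.iterate_succ_apply' _ _ _
  have hn : (S.n : ℝ) ≠ 0 := by exact_mod_cast S.n_pos.ne'
  have hm : (S.m : ℝ) ≠ 0 := by exact_mod_cast S.m_pos.ne'
  have hx (i : ℕ) : (p i).1.2.1 * S.n = (p (i + 1)).1.2.1 + S.xd (e (p i)) := by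
    rw [hp, ← hpsi (p i)]
    simp [psi, hn]
  have hy (i : ℕ) : (p i).1.2.2 * S.m = (p (i + 1)).1.2.2 + S.yd (e (p i)) := by
    rw [hp, ← hpsi (p i)]
    simp [psi, hm]
  refine ⟨fun i => e (p i), fun i => ?_, fun a b => ⟨?_, ?_⟩⟩
  · rw [he, hp, hq]
  · have key : z.1 * (S.n : ℝ) ^ a - digitVal S.n (fun i => S.xd (e (p i))) a = (p a).1.2.1 := by
      induction a with
      | zero => simp [digitVal, p]
      | succ a ih =>
        have := hx a
        rw [← ih] at this
        simp only [digitVal]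
        push_cast
        rw [pow_succ]
        linarith
    rw [InCell, key]
    exact (mem_unitSquare (p a).2).1
  · have key : z.2 * (S.m : ℝ) ^ b - digitVal S.m (fun i => S.yd (e (p i))) b = (p b).1.2.2 := by
      induction b with
      | zero => simp [digitVal, p]
      | succ b ih =>
        have := hy b
        rw [← ih] at this
        simp only [digitVal]
        push_cast
        rw [pow_succ]
        linarith
    rw [InCell, key]
    exact (mem_unitSquare (p b).2).2

theorem exists_mem_X_of_path {ω : ℕ → S.E} (hω : ω ∈ S.paths) (k : ℕ) :
    ∃ z ∈ S.Xunion, ∀ a ≤ k, ∀ b ≤ k, S.InBox ω a b z := by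
  have hn : (S.n : ℝ) ≠ 0 := by exact_mod_cast S.n_pos.ne'
  have hm : (S.m : ℝ) ≠ 0 := by exact_mod_cast S.m_pos.ne'
  suffices H : ∀ z' ∈ S.X (S.src (ω k)), ∃ z ∈ S.X (S.src (ω 0)),
      z.1 * (S.n : ℝ) ^ k - digitVal S.n (fun i => S.xd (ω i)) k = z'.1 ∧
      z.2 * (S.m : ℝ) ^ k - digitVal S.m (fun i => S.yd (ω i)) k = z'.2 ∧
      ∀ a ≤ k, InCell S.n (fun i => S.xd (ω i)) a z.1 ∧
        InCell S.m (fun i => S.yd (ω i)) a z.2 by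
    obtain ⟨z', hz'⟩ := S.X_nonempty (S.src (ω k))
    obtain ⟨z, hz, -, -, h⟩ := H z' hz'
    exact ⟨z, mem_iUnion.2 ⟨_, hz⟩, fun a ha b hb => ⟨(h a ha).1, (h b hb).2⟩⟩
  induction k with
  | zero =>
    intro z' hz'
    have := mem_unitSquare hz'
    refine ⟨z', hz', by simp [digitVal], by simp [digitVal], fun a ha => ?_⟩
    obtain rfl : a = 0 := by omega
    simpa [InCell, digitVal] using this
  | succ k ih =>
    intro z' hz'
    have hmem : S.psi (ω k) z' ∈ S.X (S.src (ω k)) :=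
      mem_X_iff.2 ⟨ω k, rfl, z', by rwa [hω k], rfl⟩
    obtain ⟨z, hz, h1, h2, h⟩ := ih _ hmem
    have e1 : z.1 * (S.n : ℝ) ^ (k + 1) - digitVal S.n (fun i => S.xd (ω i)) (k + 1) = z'.1 := by
      have h3 : (S.psi (ω k) z').1 * S.n = z'.1 + S.xd (ω k) := by simp [psi, hn]
      rw [← h1] at h3
      simp only [digitVal]
      push_cast
      rw [pow_succ]
      linarith
    have e2 : z.2 * (S.m : ℝ) ^ (k + 1) - digitVal S.m (fun i => S.yd (ω i)) (k + 1) = z'.2 := by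
      have h3 : (S.psi (ω k) z').2 * S.m = z'.2 + S.yd (ω k) := by simp [psi, hm]
      rw [← h2] at h3
      simp only [digitVal]
      push_cast
      rw [pow_succ]
      linarith
    refine ⟨z, hz, e1, e2, fun a ha => ?_⟩
    rcases Nat.le_succ_iff.1 ha with ha | rfl
    · exact h a ha
    · rw [InCell, InCell, e1, e2]
      exact mem_unitSquare hz'

/-- The first `k` `x`-digits of a path. -/
def xs (k : ℕ) (ω : ℕ → S.E) : Fin k → Fin S.n := fun i => S.xd (ω i)

/-- The first `k` `y`-digits of a path. -/
def ys (k : ℕ) (ω : ℕ → S.E) : Fin k → Fin S.m := fun i => S.yd (ω i)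

theorem xs_eq_iff {k : ℕ} {ω ω' : ℕ → S.E} :
    xs k ω = xs k ω' ↔ ∀ i < k, S.xd (ω i) = S.xd (ω' i) := by
  simp [xs, funext_iff, Fin.forall_iff]

theorem ys_eq_iff {k : ℕ} {ω ω' : ℕ → S.E} :
    ys k ω = ys k ω' ↔ ∀ i < k, S.yd (ω i) = S.yd (ω' i) := by
  simp [ys, funext_iff, Fin.forall_iff]

theorem coe_piIk [Nonempty S.V] (k : ℕ) : (S.piIk k : Set (Fin k → Fin S.m)) = ys k '' S.paths := by
  ext u
  simp only [piIk, Finset.coe_filter, Finset.mem_univ, true_and, mem_ofPred_eq]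
  constructor
  · rintro ⟨w, hw, h⟩
    obtain ⟨ω, hω, hωw⟩ := exists_path_extending hw
    exact ⟨ω, hω, funext fun i => by rw [ys, hωw, h]⟩
  · rintro ⟨ω, hω, rfl⟩
    exact ⟨fun i => ω i, isWord_of_mem_paths hω k, fun i => rfl⟩

/-- Paths whose first `k` `y`-digits agree with `y`. -/
def pathsOver (S : GDBMCarpet) (y : ℕ → Fin S.m) (k : ℕ) : Set (ℕ → S.E) :=
  {ω | ω ∈ S.paths ∧ ∀ i < k, S.yd (ω i) = y i}

theorem coe_fiberXk [Nonempty S.V] (y : ℕ → Fin S.m) (k : ℕ) :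
    (S.fiberXk y k : Set (Fin k → Fin S.n)) = xs k '' S.pathsOver y k := by
  ext u
  simp only [fiberXk, Finset.coe_filter, Finset.mem_univ, true_and, mem_ofPred_eq]
  constructor
  · rintro ⟨w, hw, h, h'⟩
    obtain ⟨ω, hω, hωw⟩ := exists_path_extending hw
    exact ⟨ω, ⟨hω, fun i hi => by rw [← h ⟨i, hi⟩, ← hωw]⟩, funext fun i => by rw [xs, hωw, h']⟩
  · rintro ⟨ω, ⟨hω, h⟩, rfl⟩
    exact ⟨fun i => ω i, isWord_of_mem_paths hω k, fun i => h i i.2, fun i => rfl⟩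

/-- The integer coordinates of the box of the first `a` `x`-digits and `b` `y`-digits. -/
def corner (a b : ℕ) (ω : ℕ → S.E) : ℤ × ℤ :=
  (digitVal S.n (fun i => S.xd (ω i)) a, digitVal S.m (fun i => S.yd (ω i)) b)

theorem digits_eq_of_corner_eq {a b : ℕ} {ω ω' : ℕ → S.E} (h : corner a b ω = corner a b ω') :
    xs a ω = xs a ω' ∧ ys b ω = ys b ω' := by
  simp only [corner, Prod.mk.injEq, Nat.cast_inj] at h
  rw [xs_eq_iff, ys_eq_iff]
  exact ⟨fun i hi => Fin.ext (eq_of_digitVal_eq (fun i => (S.xd (ω i)).2)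
      (fun i => (S.xd (ω' i)).2) h.1 i hi),
    fun i hi => Fin.ext (eq_of_digitVal_eq (fun i => (S.yd (ω i)).2)
      (fun i => (S.yd (ω' i)).2) h.2 i hi)⟩

theorem corner_eq_of_digits_eq {a b : ℕ} {ω ω' : ℕ → S.E} (hx : xs a ω = xs a ω')
    (hy : ys b ω = ys b ω') : corner a b ω = corner a b ω' := by
  rw [xs_eq_iff] at hx
  rw [ys_eq_iff] at hy
  simp only [corner]
  rw [digitVal_congr (d' := fun i => S.xd (ω' i)) fun i hi => congrArg Fin.val (hx i hi),
    digitVal_congr (d' := fun i => S.yd (ω' i)) fun i hi => congrArg Fin.val (hy i hi)]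

theorem ncard_corner_image_le {a b : ℕ} {ρ : ℝ} {c : ℝ × ℝ} {s : Set (ℕ → S.E)}
    (ha : ρ * (S.n : ℝ) ^ a ≤ 1) (hb : ρ * (S.m : ℝ) ^ b ≤ 1)
    (h : ∀ ω ∈ s, ∃ z ∈ closedBall c ρ, S.InBox ω a b z) :
    (corner a b '' s).Finite ∧ (corner a b '' s).ncard ≤ 25 := by
  set A := Finset.Icc (⌊c.1 * (S.n : ℝ) ^ a⌋ - 2) (⌊c.1 * (S.n : ℝ) ^ a⌋ + 2)
  set B := Finset.Icc (⌊c.2 * (S.m : ℝ) ^ b⌋ - 2) (⌊c.2 * (S.m : ℝ) ^ b⌋ + 2)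
  have hsub : corner a b '' s ⊆ (A ×ˢ B : Finset (ℤ × ℤ)) := by
    rintro _ ⟨ω, hω, rfl⟩
    obtain ⟨z, hz, hbox⟩ := h ω hω
    rw [mem_closedBall, Prod.dist_eq, max_le_iff, Real.dist_eq, Real.dist_eq] at hz
    exact Finset.mem_coe.2 (Finset.mem_product.2
      ⟨hbox.1.mem_window ha hz.1, hbox.2.mem_window hb hz.2⟩)
  refine ⟨(Finset.finite_toSet _).subset hsub, (ncard_le_ncard hsub (Finset.finite_toSet _)).trans ?_⟩
  rw [ncard_coe_finset, Finset.card_product, Int.card_Icc, Int.card_Icc]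
  ring_nf
  simp

/-- The code of the box of the first `a` `x`-digits and `b` `y`-digits. -/
def code (a b : ℕ) (ω : ℕ → S.E) : (Fin a → Fin S.n) × (Fin b → Fin S.m) := (xs a ω, ys b ω)

theorem ncard_code_image_le [Nonempty S.V] {L K l k M : ℕ} {s : Set (ℕ → S.E)}
    (hs : s ⊆ S.paths) (hLl : L ≤ l) (hlk : l ≤ k) (hKk : K ≤ k)
    (hfin : (corner L K '' s).Finite) (hcard : (corner L K '' s).ncard ≤ 25)
    (hM : ∀ y, (S.fiberXk y (l - L)).card ≤ M) :
    (code l k '' s).ncard ≤ 25 * ((S.piIk (k - K)).card * M) := by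
  refine ncard_image_le_mul _ (corner L K) s hfin hcard fun d _ => ?_
  refine ncard_image_le_mul _ (fun ω => ys (k - K) fun i => ω (K + i)) _ (toFinite _) ?_
    fun u _ => ?_
  · rw [← ncard_coe_finset, coe_piIk]
    refine ncard_le_ncard ?_ (toFinite _)
    rintro _ ⟨ω, hω, rfl⟩
    exact ⟨_, shift_mem_paths K (hs hω.1), rfl⟩
  set s' := {ω ∈ {ω ∈ s | corner L K ω = d} | (ys (k - K) fun i => ω (K + i)) = u}
  rcases s'.eq_empty_or_nonempty with he | ⟨ω₀, hω₀⟩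
  · simp [he]
  have hy {ω ω' : ℕ → S.E} (hω : ω ∈ s') (hω' : ω' ∈ s') : ∀ i < k, S.yd (ω i) = S.yd (ω' i) := by
    intro i hi
    rcases lt_or_ge i K with h | h
    · exact ys_eq_iff.1 (digits_eq_of_corner_eq (hω.1.2.trans hω'.1.2.symm)).2 i h
    · have := ys_eq_iff.1 (hω.2.trans hω'.2.symm) (i - K) (by omega)
      simpa [Nat.add_sub_cancel' h] using this
  refine (ncard_image_le_of_eq (code l k) (fun ω => xs (l - L) fun i => ω (L + i)) s' (toFinite _)
    fun ω hω ω' hω' h => ?_).2.trans (le_trans ?_ (hM fun i => S.yd (ω₀ (L + i))))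
  · refine Prod.ext (xs_eq_iff.2 fun i hi => ?_) (ys_eq_iff.2 (hy hω hω'))
    rcases lt_or_ge i L with h' | h'
    · exact xs_eq_iff.1 (digits_eq_of_corner_eq (hω.1.2.trans hω'.1.2.symm)).1 i h'
    · have := xs_eq_iff.1 h (i - L) (by omega)
      simpa [Nat.add_sub_cancel' h'] using this
  · rw [← ncard_coe_finset, coe_fiberXk]
    refine ncard_le_ncard ?_ (toFinite _)
    rintro _ ⟨ω, hω, rfl⟩
    exact ⟨_, ⟨shift_mem_paths L (hs hω.1.1), fun i hi => hy hω hω₀ _ (by omega)⟩, rfl⟩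

theorem coverNum_le [Nonempty S.V] {L K l k M : ℕ} {x : ℝ × ℝ} {r R : ℝ}
    (hL : R * (S.n : ℝ) ^ L ≤ 1) (hK : R * (S.m : ℝ) ^ K ≤ 1)
    (hl : 1 / (S.n : ℝ) ^ l ≤ r) (hk : 1 / (S.m : ℝ) ^ k ≤ r)
    (hLl : L ≤ l) (hlk : l ≤ k) (hKk : K ≤ k)
    (hM : ∀ y, (S.fiberXk y (l - L)).card ≤ M) :
    coverNum r (S.Xunion ∩ ball x R) ≤ 25 * ((S.piIk (k - K)).card * M) := by
  set s : Set (ℕ → S.E) := {ω | ω ∈ S.paths ∧ ∃ z ∈ closedBall x R, S.InBox ω L K z}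
  have hcorner := ncard_corner_image_le (s := s) hL hK fun ω hω => hω.2
  refine le_trans ?_ (ncard_code_image_le (fun ω hω => hω.1) hLl hlk hKk hcorner.1 hcorner.2 hM)
  set center : (ℕ → S.E) → ℝ × ℝ := fun ω =>
    ((corner l k ω).1 / (S.n : ℝ) ^ l, (corner l k ω).2 / (S.m : ℝ) ^ k)
  obtain ⟨hfin, hle⟩ := ncard_image_le_of_eq center (code l k) s (toFinite _)
    fun ω _ ω' _ h => by
      have h' := corner_eq_of_digits_eq (congrArg Prod.fst h) (congrArg Prod.snd h)
      simp only [center, h']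
  refine le_trans (Nat.sInf_le ⟨hfin.toFinset, rfl, ?_⟩)
    ((ncard_eq_toFinset_card _ hfin).symm.le.trans hle)
  rintro z ⟨hz, hzx⟩
  obtain ⟨v, hv⟩ := mem_iUnion.1 hz
  obtain ⟨ω, hω, hbox⟩ := exists_path_coding hv
  have hωs : ω ∈ s := ⟨hω, z, ball_subset_closedBall hzx, hbox L K⟩
  simp only [mem_iUnion]
  refine ⟨center ω, hfin.mem_toFinset.2 ⟨ω, hωs, rfl⟩, ?_⟩
  rw [mem_closedBall, Prod.dist_eq, max_le_iff, Real.dist_eq, Real.dist_eq]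
  have h1 := ((hbox l k).1.abs_sub_corner_le S.n_pos).trans hl
  have h2 := ((hbox l k).2.abs_sub_corner_le S.m_pos).trans hk
  exact ⟨by simpa [center, corner] using h1, by simpa [center, corner] using h2⟩

theorem exists_finset_cover (x : ℝ × ℝ) (R : ℝ) {r : ℝ} (hr : 0 < r) :
    ∃ T : Finset (ℝ × ℝ), T.card = coverNum r (S.Xunion ∩ ball x R) ∧
      S.Xunion ∩ ball x R ⊆ ⋃ c ∈ T, closedBall c r := by
  refine Nat.sInf_mem (s := {k : ℕ | ∃ T : Finset (ℝ × ℝ), T.card = k ∧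
    S.Xunion ∩ ball x R ⊆ ⋃ c ∈ T, closedBall c r}) ?_
  have hc : IsCompact S.Xunion := isCompact_iUnion S.X_compact
  obtain ⟨t, ht, h⟩ := Metric.totallyBounded_iff.1 (hc.totallyBounded.subset inter_subset_left) r hr
  refine ⟨_, ht.toFinset, rfl, h.trans ?_⟩
  simp only [ht.mem_toFinset]
  exact iUnion₂_mono fun c _ => ball_subset_closedBall

theorem exists_ncard_code_le_coverNum {L K l k : ℕ} {r R : ℝ} {s : Set (ℕ → S.E)}
    (hs : s ⊆ S.paths) (hne : s.Nonempty)
    (hx : ∀ ω ∈ s, ∀ ω' ∈ s, ∀ i < L, S.xd (ω i) = S.xd (ω' i))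
    (hy : ∀ ω ∈ s, ∀ ω' ∈ s, ∀ i < K, S.yd (ω i) = S.yd (ω' i))
    (hL : 1 / (S.n : ℝ) ^ L < R) (hK : 1 / (S.m : ℝ) ^ K < R) (hr : 0 < r)
    (hl : r * (S.n : ℝ) ^ l ≤ 1) (hk : r * (S.m : ℝ) ^ k ≤ 1) :
    ∃ x ∈ S.Xunion, (code l k '' s).ncard ≤ coverNum r (S.Xunion ∩ ball x R) * 25 := by
  obtain ⟨ω₀, hω₀⟩ := hne
  have hpt (ω : ℕ → S.E) : ∃ z : ℝ × ℝ, ω ∈ s → z ∈ S.Xunion ∧ S.InBox ω L K z ∧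
      S.InBox ω l k z := by
    by_cases hω : ω ∈ s
    · obtain ⟨z, hz, h⟩ := exists_mem_X_of_path (hs hω) (L + K + l + k)
      exact ⟨z, fun _ => ⟨hz, h _ (by omega) _ (by omega), h _ (by omega) _ (by omega)⟩⟩
    · exact ⟨0, fun h => absurd h hω⟩
  choose z hz using hpt
  obtain ⟨T, hT, hcov⟩ := exists_finset_cover (S := S) (z ω₀) R hr
  have hball (ω : ℕ → S.E) (hω : ω ∈ s) : z ω ∈ ball (z ω₀) R := by
    rw [mem_ball, Prod.dist_eq, max_lt_iff, Real.dist_eq, Real.dist_eq]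
    exact ⟨((hz ω hω).2.1.1.abs_sub_le S.n_pos (hz ω₀ hω₀).2.1.1
        fun i hi => congrArg Fin.val (hx ω hω ω₀ hω₀ i hi)).trans_lt hL,
      ((hz ω hω).2.1.2.abs_sub_le S.m_pos (hz ω₀ hω₀).2.1.2
        fun i hi => congrArg Fin.val (hy ω hω ω₀ hω₀ i hi)).trans_lt hK⟩
  have hctr (ω : ℕ → S.E) : ∃ c, ω ∈ s → c ∈ T ∧ z ω ∈ closedBall c r := by
    by_cases hω : ω ∈ s
    · have := hcov ⟨(hz ω hω).1, hball ω hω⟩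
      simp only [mem_iUnion] at this
      obtain ⟨c, hc, h⟩ := this
      exact ⟨c, fun _ => ⟨hc, h⟩⟩
    · exact ⟨0, fun h => absurd h hω⟩
  choose c hc using hctr
  have hsub : c '' s ⊆ T := by
    rintro _ ⟨ω, hω, rfl⟩
    exact (hc ω hω).1
  refine ⟨z ω₀, (hz ω₀ hω₀).1, ncard_image_le_mul _ c s (T.finite_toSet.subset hsub) ?_
    fun d _ => ?_⟩
  · rw [← hT, ← ncard_coe_finset]
    exact ncard_le_ncard hsub T.finite_toSet
  · have := ncard_corner_image_le (s := {ω ∈ s | c ω = d}) (c := d) hl hk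
      fun ω hω => ⟨z ω, hω.2 ▸ (hc ω hω.1).2, (hz ω hω.1).2.2⟩
    exact (ncard_image_le_of_eq _ (corner l k) _ this.1 fun ω _ ω' _ h =>
      Prod.ext (digits_eq_of_corner_eq h).1 (digits_eq_of_corner_eq h).2).2.trans this.2

theorem exists_ncard_image_le_card_mul {α β γ : Type*} [Fintype β] [Nonempty β] [Finite γ]
    (g : α → γ) (f : α → β) (s : Set α) :
    ∃ b, (g '' s).ncard ≤ Fintype.card β * (g '' {a ∈ s | f a = b}).ncard := by
  obtain ⟨b, hb⟩ := Finite.exists_max fun b => (g '' {a ∈ s | f a = b}).ncard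
  refine ⟨b, ncard_image_le_mul g f s (toFinite _) ?_ fun d _ => hb d⟩
  rw [← Nat.card_eq_fintype_card]
  exact ncard_le_card _

theorem GraphIrreducible.exists_long_path (hirr : S.GraphIrreducible) :
    ∃ B, ∀ (v v' : S.V) (D₀ : ℕ), ∃ D, D₀ ≤ D ∧ D ≤ D₀ + B ∧
      ∃ ω ∈ S.paths, S.src (ω 0) = v ∧ S.src (ω D) = v' := by
  obtain ⟨B, hB⟩ := hirr.exists_bound
  refine ⟨B, fun v v' D₀ => ?_⟩
  obtain ⟨ω, hω, h0⟩ := exists_path_from v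
  obtain ⟨c, -, hc, ω', hω', h0', h1'⟩ := hB (S.src (ω D₀)) v'
  refine ⟨D₀ + c, by omega, by omega, splice D₀ ω ω', splice_mem_paths hω hω' h0'.symm, ?_, ?_⟩
  · rw [src_splice_zero h0'.symm, h0]
  · rw [splice_add, h1']

theorem GraphIrreducible.card_mul_card_le_coverNum [Nonempty S.V] (hirr : S.GraphIrreducible) :
    ∃ B, ∀ (y : ℕ → Fin S.m) (j t L K : ℕ) (r R : ℝ), L + j ≤ K →
      1 / (S.n : ℝ) ^ L < R → 1 / (S.m : ℝ) ^ K < R → 0 < r → r * (S.n : ℝ) ^ (L + j) ≤ 1 →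
      r * (S.m : ℝ) ^ (K + B + t) ≤ 1 → ∃ x ∈ S.Xunion,
        (S.fiberXk y j).card * (S.piIk t).card ≤
          25 * Fintype.card S.V ^ 3 * coverNum r (S.Xunion ∩ ball x R) := by
  obtain ⟨B, hB⟩ := hirr.exists_long_path
  refine ⟨B, fun y j t L K r R hLK hL hK hr hl hk => ?_⟩
  obtain ⟨⟨v, v'⟩, hv⟩ := exists_ncard_image_le_card_mul (xs j)
    (fun ω => (S.src (ω 0), S.src (ω j))) (S.pathsOver y j)
  obtain ⟨v'', hv''⟩ := exists_ncard_image_le_card_mul (ys t) (fun ω => S.src (ω 0)) S.paths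
  set s₁ := {ω ∈ S.pathsOver y j | (S.src (ω 0), S.src (ω j)) = (v, v')}
  set s₂ := {ω ∈ S.paths | S.src (ω 0) = v''}
  rw [← coe_fiberXk, ncard_coe_finset, Fintype.card_prod] at hv
  rw [← coe_piIk, ncard_coe_finset] at hv''
  obtain ⟨pre, hpre, hpreL⟩ := hirr.exists_path_to L v
  obtain ⟨D, hD, hD', mid, hmid, hmid0, hmidD⟩ := hB v' v'' (K - (L + j))
  set Φ : (ℕ → S.E) × (ℕ → S.E) → (ℕ → S.E) := fun p =>
    splice L pre (splice j p.1 (splice D mid p.2))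
  set s := Φ '' (s₁ ×ˢ s₂)
  have hΦx {p} {i} (hi : i < j) : Φ p (L + i) = p.1 i := by
    simp only [Φ, splice_add]
    exact splice_of_lt hi
  have hΦmid {p} {i} (hi : i < D) : Φ p (L + (j + i)) = mid i := by
    simp only [Φ, splice_add]
    exact splice_of_lt hi
  have hΦy {p} {i} : Φ p (L + (j + (D + i))) = p.2 i := by
    simp only [Φ, splice_add]
  have hΦpre {p} {i} (hi : i < L) : Φ p i = pre i := splice_of_lt hi
  have hs : s ⊆ S.paths := by
    rintro _ ⟨⟨u, w⟩, ⟨⟨hu, huv⟩, hw, hwv⟩, rfl⟩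
    obtain ⟨hu0, huj⟩ := Prod.mk.inj huv
    have h1 : S.src (mid D) = S.src (w 0) := hmidD.trans hwv.symm
    have h2 : S.src (u j) = S.src (splice D mid w 0) := by rw [src_splice_zero h1, hmid0, huj]
    have h3 : S.src (pre L) = S.src (splice j u (splice D mid w) 0) := by
      rw [src_splice_zero h2, hu0, hpreL]
    exact splice_mem_paths hpre (splice_mem_paths hu.1 (splice_mem_paths hmid hw h1) h2) h3
  have hprod : (xs j '' s₁).ncard * (ys t '' s₂).ncard ≤
      (code (L + j) (K + B + t) '' s).ncard := by
    rw [← ncard_prod]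
    have himg : (xs j '' s₁) ×ˢ (ys t '' s₂) =
        (fun ω => (xs j fun i => ω (L + i), ys t fun i => ω (L + (j + (D + i))))) '' s := by
      rw [image_image, ← prodMap_image_prod]
      refine image_congr fun p _ => ?_
      have h1 : xs j p.1 = xs j fun i => Φ p (L + i) :=
        xs_eq_iff.2 fun i hi => by rw [hΦx hi]
      have h2 : ys t p.2 = ys t fun i => Φ p (L + (j + (D + i))) :=
        ys_eq_iff.2 fun i _ => by rw [hΦy]
      exact Prod.ext h1 h2
    rw [himg]
    refine (ncard_image_le_of_eq _ (code (L + j) (K + B + t)) s (toFinite _)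
      fun ω _ ω' _ h => ?_).2
    have h1 : (xs j fun i => ω (L + i)) = xs j fun i => ω' (L + i) :=
      xs_eq_iff.2 fun i hi => xs_eq_iff.1 (congrArg Prod.fst h) (L + i) (by omega)
    have h2 : (ys t fun i => ω (L + (j + (D + i)))) = ys t fun i => ω' (L + (j + (D + i))) :=
      ys_eq_iff.2 fun i hi =>
        ys_eq_iff.1 (congrArg Prod.snd h) (L + (j + (D + i))) (by omega)
    exact Prod.ext h1 h2
  have hle : (S.fiberXk y j).card * (S.piIk t).card ≤
      Fintype.card S.V ^ 3 * (code (L + j) (K + B + t) '' s).ncard :=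
    calc _ ≤ _ := Nat.mul_le_mul hv hv''
      _ = Fintype.card S.V ^ 3 * ((xs j '' s₁).ncard * (ys t '' s₂).ncard) := by ring
      _ ≤ _ := Nat.mul_le_mul_left _ hprod
  rcases s.eq_empty_or_nonempty with he | hne
  · obtain ⟨z, hz, -⟩ := exists_mem_X_of_path hpre 0
    refine ⟨z, hz, hle.trans ?_⟩
    simp [he]
  have hm1 : (1 : ℝ) ≤ S.m := by exact_mod_cast S.m_pos
  have hm0 : (0 : ℝ) < S.m := by exact_mod_cast S.m_pos
  have hpow : 1 / (S.m : ℝ) ^ (L + j + D) ≤ 1 / (S.m : ℝ) ^ K :=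
    one_div_le_one_div_of_le (by positivity) (pow_le_pow_right₀ hm1 (by omega))
  have hxd : ∀ ω ∈ s, ∀ ω' ∈ s, ∀ i < L, S.xd (ω i) = S.xd (ω' i) := by
    rintro _ ⟨p, -, rfl⟩ _ ⟨p', -, rfl⟩ i hi
    rw [hΦpre hi, hΦpre hi]
  have hyd : ∀ ω ∈ s, ∀ ω' ∈ s, ∀ i < L + j + D, S.yd (ω i) = S.yd (ω' i) := by
    rintro _ ⟨p, hp, rfl⟩ _ ⟨p', hp', rfl⟩ i hi
    rcases lt_or_ge i L with h | h
    · rw [hΦpre h, hΦpre h]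
    rcases lt_or_ge i (L + j) with h' | h'
    · obtain ⟨i, rfl⟩ := Nat.exists_eq_add_of_le h
      have hij : i < j := by omega
      rw [hΦx hij, hΦx hij, hp.1.1.2 i hij, hp'.1.1.2 i hij]
    · obtain ⟨i, rfl⟩ := Nat.exists_eq_add_of_le h'
      rw [add_assoc, hΦmid (by omega), hΦmid (by omega)]
  obtain ⟨x, hx, h⟩ :=
    exists_ncard_code_le_coverNum hs hne hxd hyd hL (hpow.trans_lt hK) hr hl hk
  exact ⟨x, hx, hle.trans ((Nat.mul_le_mul_left _ h).trans_eq (by ring))⟩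

theorem exists_periodic_fiber [Nonempty S.V] {q : ℕ} (hq : 0 < q) {v : S.V} {Y : ℕ → Fin S.m}
    {s : Set (ℕ → S.E)} (hs : s ⊆ S.paths) (hne : s.Nonempty)
    (h : ∀ ω ∈ s, S.src (ω 0) = v ∧ S.src (ω q) = v ∧ ∀ i < q, S.yd (ω i) = Y i) :
    ∃ y ∈ S.piI, ∀ j, (xs q '' s).ncard ^ j ≤ (S.fiberXk y (j * q)).card := by
  set T := xs q '' s
  have hT (t : T) : ∃ ω ∈ s, xs q ω = t := t.2
  choose β hβs hβ using hT
  obtain ⟨ω₀, hω₀⟩ := hne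
  let t₀ : T := ⟨xs q ω₀, ω₀, hω₀, rfl⟩
  let Ψ : (ℕ → T) → ℕ → S.E := fun σ i => β (σ (i / q)) (i % q)
  have hΨ (σ : ℕ → T) : Ψ σ ∈ S.paths := by
    intro i
    have hlt := Nat.mod_lt i hq
    have hdm := Nat.div_add_mod i q
    rcases Nat.lt_or_ge (i % q + 1) q with h1 | h1
    · have e : i + 1 = i % q + 1 + q * (i / q) := by omega
      have e1 : (i + 1) / q = i / q := by
        rw [e, Nat.add_mul_div_left _ _ hq, Nat.div_eq_of_lt h1, zero_add]
      have e2 : (i + 1) % q = i % q + 1 := by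
        rw [e, Nat.add_mul_mod_self_left, Nat.mod_eq_of_lt h1]
      simp only [Ψ, e1, e2]
      exact hs (hβs _) _
    · have hq1 : i % q + 1 = q := by omega
      have e : i + 1 = 0 + q * (i / q + 1) := by rw [mul_add, mul_one]; omega
      have e2 : (i + 1) % q = 0 := by rw [e, Nat.add_mul_mod_self_left, Nat.zero_mod]
      simp only [Ψ, e2]
      rw [hs (hβs _), hq1, (h _ (hβs _)).2.1, (h _ (hβs _)).1]
  have hΨy (σ : ℕ → T) (i : ℕ) : S.yd (Ψ σ i) = Y (i % q) :=
    (h _ (hβs _)).2.2 _ (Nat.mod_lt i hq)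
  refine ⟨fun i => Y (i % q), ⟨Ψ fun _ => t₀, hΨ fun _ => t₀, hΨy fun _ => t₀⟩, fun j => ?_⟩
  let ext : (Fin j → T) → ℕ → T := fun σ i => if hi : i < j then σ ⟨i, hi⟩ else t₀
  have hmem (σ : Fin j → T) : xs (j * q) (Ψ (ext σ)) ∈ S.fiberXk (fun i => Y (i % q)) (j * q) := by
    rw [← Finset.mem_coe, coe_fiberXk]
    exact ⟨_, ⟨hΨ _, fun i _ => hΨy _ i⟩, rfl⟩
  have hinj : Function.Injective
      fun σ : Fin j → T => (⟨_, hmem σ⟩ : S.fiberXk (fun i => Y (i % q)) (j * q)) := by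
    intro σ σ' hσ
    have hσ' := xs_eq_iff.1 (congrArg Subtype.val hσ)
    funext b
    apply Subtype.ext
    rw [← hβ, ← hβ]
    refine xs_eq_iff.2 fun i hi => ?_
    have hlt : i + q * b < j * q := by
      calc i + q * b < q * (b + 1) := by rw [mul_add, mul_one]; omega
        _ ≤ q * j := Nat.mul_le_mul_left _ b.2
        _ = j * q := mul_comm _ _
    have := hσ' (i + q * b) hlt
    simpa [Ψ, ext, Nat.add_mul_div_left _ _ hq, Nat.div_eq_of_lt hi, Nat.mod_eq_of_lt hi] using this
  have := Nat.card_le_card_of_injective _ hinj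
  rwa [Nat.card_fun, Nat.card_coe_set_eq, Nat.card_eq_fintype_card (α := Fin j),
    Nat.card_eq_fintype_card, Fintype.card_fin, Fintype.card_coe] at this

theorem card_fiberXk_le (y : ℕ → Fin S.m) (k : ℕ) : (S.fiberXk y k).card ≤ S.n ^ k := by
  simpa using Finset.card_le_univ (S.fiberXk y k)

theorem card_piIk_le (k : ℕ) : (S.piIk k).card ≤ S.m ^ k := by
  simpa using Finset.card_le_univ (S.piIk k)

theorem log_card_div_nonneg (c : ℕ → ℕ) (k : ℕ) : 0 ≤ Real.log (c k) / (k : ℝ) :=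
  div_nonneg (Real.log_natCast_nonneg _) (Nat.cast_nonneg _)

theorem log_card_div_le {b : ℕ} {c : ℕ → ℕ} (h : ∀ k, c k ≤ b ^ k) (k : ℕ) :
    Real.log (c k) / (k : ℝ) ≤ Real.log b := by
  refine div_le_of_le_mul₀ (Nat.cast_nonneg _) (Real.log_natCast_nonneg _) ?_
  rcases Nat.eq_zero_or_pos (c k) with h0 | h0
  · simpa [h0] using mul_nonneg (Real.log_natCast_nonneg b) (Nat.cast_nonneg k)
  · rw [mul_comm, ← Real.log_pow]
    exact Real.log_le_log (by exact_mod_cast h0) (by exact_mod_cast h k)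

theorem isBoundedUnder_le_log_card_div {b : ℕ} {c : ℕ → ℕ} (h : ∀ k, c k ≤ b ^ k) :
    IsBoundedUnder (· ≤ ·) atTop fun k : ℕ => Real.log (c k) / (k : ℝ) :=
  isBoundedUnder_of ⟨_, log_card_div_le h⟩

theorem isCoboundedUnder_le_log_card_div (c : ℕ → ℕ) :
    IsCoboundedUnder (· ≤ ·) atTop fun k : ℕ => Real.log (c k) / (k : ℝ) :=
  (isBoundedUnder_of ⟨0, log_card_div_nonneg c⟩ :
    IsBoundedUnder (· ≥ ·) atTop _).isCoboundedUnder_le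

theorem limsup_log_card_div_nonneg {b : ℕ} {c : ℕ → ℕ} (h : ∀ k, c k ≤ b ^ k) :
    0 ≤ limsup (fun k : ℕ => Real.log (c k) / (k : ℝ)) atTop :=
  le_limsup_of_frequently_le (Frequently.of_forall (log_card_div_nonneg c))
    (isBoundedUnder_le_log_card_div h)

theorem limsup_log_card_div_le_of_le_mul_exp {c : ℕ → ℕ} {C a : ℝ} (hpos : ∀ k, 0 < c k)
    (h : ∀ k : ℕ, (c k : ℝ) ≤ C * Real.exp (a * k)) :
    limsup (fun k : ℕ => Real.log (c k) / (k : ℝ)) atTop ≤ a := by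
  have hC : 0 < C := by
    have h1 : (0 : ℝ) < c 0 := by exact_mod_cast hpos 0
    have h2 := h 0
    simp only [Nat.cast_zero, mul_zero, Real.exp_zero, mul_one] at h2
    linarith
  have ht : Tendsto (fun k : ℕ => Real.log C / (k : ℝ) + a) atTop (𝓝 a) := by
    simpa using (tendsto_const_div_atTop_nhds_zero_nat (Real.log C)).add_const a
  rw [← ht.limsup_eq]
  refine limsup_le_limsup ?_ (isCoboundedUnder_le_log_card_div c) ht.isBoundedUnder_le
  filter_upwards [eventually_gt_atTop 0] with k hk
  have hk' : (0 : ℝ) < k := by exact_mod_cast hk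
  rw [div_le_iff₀ hk', add_mul, div_mul_cancel₀ _ hk'.ne']
  have h1 := Real.log_le_log (by exact_mod_cast hpos k) (h k)
  rwa [Real.log_mul hC.ne' (Real.exp_ne_zero _), Real.log_exp] at h1

theorem exists_le_mul_exp_of_limsup_lt {b : ℕ} {c : ℕ → ℕ} {a : ℝ} (hb : 1 ≤ b)
    (h : ∀ k, c k ≤ b ^ k) (ha : limsup (fun k : ℕ => Real.log (c k) / (k : ℝ)) atTop < a) :
    ∃ C : ℝ, 0 < C ∧ ∀ k : ℕ, (c k : ℝ) ≤ C * Real.exp (a * k) := by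
  have ha0 : 0 ≤ a := (limsup_log_card_div_nonneg h).trans ha.le
  obtain ⟨k₀, hk₀⟩ := eventually_atTop.1
    (eventually_lt_of_limsup_lt ha (isBoundedUnder_le_log_card_div h))
  have hb1 : (1 : ℝ) ≤ b := by exact_mod_cast hb
  refine ⟨(b : ℝ) ^ (k₀ + 1), by positivity, fun k => ?_⟩
  rcases Nat.lt_or_ge k (k₀ + 1) with hk | hk
  · calc (c k : ℝ) ≤ (b : ℝ) ^ k := by exact_mod_cast h k
      _ ≤ (b : ℝ) ^ (k₀ + 1) := pow_le_pow_right₀ hb1 hk.le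
      _ ≤ _ := le_mul_of_one_le_right (by positivity) (Real.one_le_exp (by positivity))
  · rcases Nat.eq_zero_or_pos (c k) with h0 | h0
    · rw [h0, Nat.cast_zero]
      positivity
    have hk' : (0 : ℝ) < k := by exact_mod_cast (by omega : 0 < k)
    have h1 := (div_lt_iff₀ hk').1 (hk₀ k (by omega))
    have h2 : (c k : ℝ) ≤ Real.exp (a * k) :=
      (Real.log_le_iff_le_exp (by exact_mod_cast h0)).1 h1.le
    exact h2.trans (le_mul_of_one_le_left (Real.exp_pos _).le (one_le_pow₀ hb1))

theorem card_piIk_pos [Nonempty S.V] (k : ℕ) : 0 < (S.piIk k).card := by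
  obtain ⟨ω, hω, -⟩ := exists_path_from (Classical.arbitrary S.V)
  refine Finset.card_pos.2 ⟨ys k ω, ?_⟩
  rw [← Finset.mem_coe, coe_piIk]
  exact ⟨ω, hω, rfl⟩

theorem card_piIk_add_le [Nonempty S.V] (a b : ℕ) :
    (S.piIk (a + b)).card ≤ (S.piIk a).card * (S.piIk b).card := by
  rw [← ncard_coe_finset, ← ncard_coe_finset, ← ncard_coe_finset, ← ncard_prod]
  simp only [coe_piIk]
  refine (ncard_image_le_of_eq (ys (a + b)) (fun ω => (ys a ω, ys b fun i => ω (a + i)))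
    S.paths (toFinite _) fun ω _ ω' _ h => ?_).2.trans (ncard_le_ncard ?_ (toFinite _))
  · refine ys_eq_iff.2 fun i hi => ?_
    rcases lt_or_ge i a with h' | h'
    · exact ys_eq_iff.1 (congrArg Prod.fst h) i h'
    · have hb : (ys b fun i => ω (a + i)) = ys b fun i => ω' (a + i) := congrArg Prod.snd h
      have := ys_eq_iff.1 hb (i - a) (by omega)
      simpa [Nat.add_sub_cancel' h'] using this
  · rintro _ ⟨ω, hω, rfl⟩
    exact ⟨⟨ω, hω, rfl⟩, ⟨_, shift_mem_paths a hω, rfl⟩⟩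

theorem exp_hTopPiI_le_card [Nonempty S.V] (k : ℕ) :
    Real.exp (S.hTopPiI * k) ≤ (S.piIk k).card := by
  have hsub : Subadditive fun k => Real.log (S.piIk k).card := fun a b => by
    have ha : ((S.piIk a).card : ℝ) ≠ 0 := by exact_mod_cast (card_piIk_pos a).ne'
    have hb : ((S.piIk b).card : ℝ) ≠ 0 := by exact_mod_cast (card_piIk_pos b).ne'
    rw [← Real.log_mul ha hb]
    exact Real.log_le_log (by exact_mod_cast card_piIk_pos _) (by exact_mod_cast card_piIk_add_le a b)
  have hbdd : BddBelow (range fun k : ℕ => Real.log (S.piIk k).card / (k : ℝ)) :=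
    ⟨0, by rintro _ ⟨k, rfl⟩; exact log_card_div_nonneg (fun k => (S.piIk k).card) k⟩
  have hlim : S.hTopPiI = hsub.lim := (hsub.tendsto_lim hbdd).limsup_eq
  rcases Nat.eq_zero_or_pos k with rfl | hk
  · simpa using card_piIk_pos (S := S) 0
  · rw [← Real.le_log_iff_exp_le (by exact_mod_cast card_piIk_pos k), hlim]
    exact (le_div_iff₀ (by exact_mod_cast hk)).1 (hsub.lim_le_div hbdd hk.ne')

theorem hTopPiI_nonneg : 0 ≤ S.hTopPiI := limsup_log_card_div_nonneg card_piIk_le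

theorem hTopFiber_nonneg (y : ℕ → Fin S.m) : 0 ≤ S.hTopFiber y :=
  limsup_log_card_div_nonneg (card_fiberXk_le y)

theorem hTopFiber_le_log (y : ℕ → Fin S.m) : S.hTopFiber y ≤ Real.log S.n :=
  limsup_le_of_le (isCoboundedUnder_le_log_card_div _)
    (Eventually.of_forall (log_card_div_le (card_fiberXk_le y)))

theorem hTopFiber_le_iSup {y : ℕ → Fin S.m} (hy : y ∈ S.piI) :
    S.hTopFiber y ≤ ⨆ y ∈ S.piI, S.hTopFiber y := by
  refine (ciSup_pos hy (f := fun _ => S.hTopFiber y)).symm.le.trans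
    (le_ciSup (f := fun y => ⨆ _ : y ∈ S.piI, S.hTopFiber y) ⟨Real.log S.n, ?_⟩ y)
  rintro _ ⟨y, rfl⟩
  exact Real.iSup_le (fun _ => hTopFiber_le_log y) (Real.log_natCast_nonneg _)

theorem iSup_hTopFiber_nonneg : 0 ≤ ⨆ y ∈ S.piI, S.hTopFiber y :=
  Real.iSup_nonneg fun y => Real.iSup_nonneg fun _ => hTopFiber_nonneg y

theorem GraphIrreducible.exists_card_fiberXk_le [Nonempty S.V] (hirr : S.GraphIrreducible) :
    ∃ C : ℝ, 0 < C ∧ ∀ (y : ℕ → Fin S.m) (k : ℕ), ((S.fiberXk y k).card : ℝ) ≤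
      C * Real.exp ((⨆ y ∈ S.piI, S.hTopFiber y) * k) := by
  set F := ⨆ y ∈ S.piI, S.hTopFiber y
  have hF : 0 ≤ F := iSup_hTopFiber_nonneg
  obtain ⟨B, hB⟩ := hirr.exists_bound
  refine ⟨Fintype.card (S.V × S.V) * Real.exp (F * B), ?_, fun y k => ?_⟩
  · have : (0 : ℝ) < Fintype.card (S.V × S.V) := by exact_mod_cast Fintype.card_pos
    positivity
  obtain ⟨⟨v, v'⟩, hv⟩ := exists_ncard_image_le_card_mul (xs k)
    (fun ω => (S.src (ω 0), S.src (ω k))) (S.pathsOver y k)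
  set s₁ := {ω ∈ S.pathsOver y k | (S.src (ω 0), S.src (ω k)) = (v, v')}
  rw [← coe_fiberXk, ncard_coe_finset] at hv
  suffices H : ((xs k '' s₁).ncard : ℝ) ≤ Real.exp (F * (k + B)) by
    calc ((S.fiberXk y k).card : ℝ) ≤ Fintype.card (S.V × S.V) * (xs k '' s₁).ncard := by
          exact_mod_cast hv
      _ ≤ Fintype.card (S.V × S.V) * Real.exp (F * (k + B)) := by gcongr
      _ = _ := by rw [mul_add, add_comm, Real.exp_add, mul_assoc]
  rcases s₁.eq_empty_or_nonempty with he | hne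
  · rw [he, image_empty, ncard_empty, Nat.cast_zero]
    exact (Real.exp_pos _).le
  obtain ⟨c, hc, hcB, ret, hret, hret0, hretc⟩ := hB v' v
  have hjoin {ω} (hω : ω ∈ s₁) : S.src (ω k) = S.src (ret 0) :=
    (Prod.mk.inj hω.2).2.trans hret0.symm
  obtain ⟨y', hy', hcount⟩ := exists_periodic_fiber (q := k + c) (by omega) (v := v)
    (Y := splice k y fun i => S.yd (ret i)) (s := (fun ω => splice k ω ret) '' s₁)
    (by rintro _ ⟨ω, hω, rfl⟩; exact splice_mem_paths hω.1.1 hret (hjoin hω))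
    (hne.image _) (by
      rintro _ ⟨ω, hω, rfl⟩
      refine ⟨(src_splice_zero (hjoin hω)).trans (Prod.mk.inj hω.2).1, ?_, fun i hi => ?_⟩
      · simp only [splice_add, hretc]
      · rcases lt_or_ge i k with h | h
        · simp only [splice_of_lt h, hω.1.2 i h]
        · simp only [splice_of_le h])
  have hge : (xs k '' s₁).ncard ≤ (xs (k + c) '' ((fun ω => splice k ω ret) '' s₁)).ncard := by
    rw [image_image]
    refine (ncard_image_le_of_eq (xs k) _ s₁ (toFinite _) fun ω _ ω' _ h => ?_).2
    refine xs_eq_iff.2 fun i hi => ?_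
    have := xs_eq_iff.1 h i (by omega)
    rwa [splice_of_lt hi, splice_of_lt hi] at this
  have hpos : (0 : ℝ) < (xs k '' s₁).ncard := by
    exact_mod_cast (ncard_pos (toFinite _)).2 (hne.image _)
  have hq : (0 : ℝ) < k + c := by
    have : (0 : ℝ) < c := by exact_mod_cast hc
    positivity
  have hent : Real.log (xs k '' s₁).ncard / (k + c) ≤ F := by
    refine le_trans ?_ (hTopFiber_le_iSup hy')
    refine le_limsup_of_frequently_le (frequently_atTop.2 fun a => ⟨(a + 1) * (k + c), ?_, ?_⟩)
      (isBoundedUnder_le_log_card_div (card_fiberXk_le y'))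
    · exact (Nat.le_succ a).trans (Nat.le_mul_of_pos_right _ (by omega))
    · have h1 : ((xs k '' s₁).ncard : ℝ) ^ (a + 1) ≤ (S.fiberXk y' ((a + 1) * (k + c))).card := by
        exact_mod_cast (Nat.pow_le_pow_left hge _).trans (hcount (a + 1))
      have h2 := Real.log_le_log (by positivity) h1
      rw [Real.log_pow] at h2
      have ha : (0 : ℝ) < (a + 1 : ℕ) := by positivity
      calc _ = ((a + 1 : ℕ) * Real.log (xs k '' s₁).ncard) / ((a + 1 : ℕ) * (k + c)) :=
            (mul_div_mul_left _ _ ha.ne').symm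
        _ ≤ _ := by
          rw [Nat.cast_mul, Nat.cast_add k c]
          gcongr
  rw [div_le_iff₀ hq] at hent
  rw [← Real.log_le_iff_le_exp hpos]
  refine hent.trans (mul_le_mul_of_nonneg_left ?_ hF)
  gcongr

theorem exists_levels {b : ℕ} (hb : 1 < b) {r R : ℝ} (hr : 0 < r) (hrR : r < R) (hR : R ≤ 1) :
    ∃ L l, L ≤ l + 1 ∧ R * (b : ℝ) ^ L ≤ 1 ∧ r * (b : ℝ) ^ l ≤ 1 ∧ 1 < r * (b : ℝ) ^ (l + 1) ∧
      (b : ℝ) ^ (l + 1 - L) ≤ (b : ℝ) ^ 2 * (R / r) := by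
  have hb' : (1 : ℝ) < b := by exact_mod_cast hb
  have hR0 : 0 < R := hr.trans hrR
  obtain ⟨L, hL, hL'⟩ := exists_nat_pow_near ((one_le_div hR0).2 hR) hb'
  obtain ⟨l, hl, hl'⟩ := exists_nat_pow_near ((one_le_div hr).2 (hrR.le.trans hR)) hb'
  rw [le_div_iff₀ hR0, mul_comm] at hL
  rw [le_div_iff₀ hr, mul_comm] at hl
  rw [div_lt_iff₀ hR0, mul_comm] at hL'
  rw [div_lt_iff₀ hr, mul_comm] at hl'
  have hLl : L < l + 1 := by
    rw [← pow_lt_pow_iff_right₀ hb']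
    by_contra! h
    have : r * (b : ℝ) ^ (l + 1) ≤ R * (b : ℝ) ^ L := by gcongr
    linarith
  refine ⟨L, l, hLl.le, hL, hl, hl', ?_⟩
  rw [← mul_div_assoc, le_div_iff₀ hr]
  calc (b : ℝ) ^ (l + 1 - L) * r ≤ (b : ℝ) ^ (l + 1 - L) * r * (R * (b : ℝ) ^ (L + 1)) :=
        le_mul_of_one_le_right (by positivity) hL'.le
    _ = (b : ℝ) ^ (l + 1 - L + L) * b * r * R := by ring
    _ = (r * (b : ℝ) ^ l) * ((b : ℝ) ^ 2 * R) := by rw [Nat.sub_add_cancel hLl.le]; ring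
    _ ≤ 1 * ((b : ℝ) ^ 2 * R) := by gcongr
    _ = _ := one_mul _

theorem exp_mul_log_mul_le {b : ℕ} (hb : 0 < b) {w ρ : ℝ} (hw : 0 ≤ w) (hρ : 0 ≤ ρ) {t : ℕ}
    (h : (b : ℝ) ^ t ≤ (b : ℝ) ^ 2 * ρ) :
    Real.exp (w * Real.log b * t) ≤ ((b : ℝ) ^ 2) ^ w * ρ ^ w := by
  have hb' : (0 : ℝ) < b := by exact_mod_cast hb
  rw [← Real.mul_rpow (by positivity) hρ]
  refine le_trans (le_of_eq ?_) (Real.rpow_le_rpow (by positivity) h hw)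
  rw [Real.rpow_def_of_pos (by positivity), Real.log_pow]
  ring_nf

theorem log_m_pos (S : GDBMCarpet) : 0 < Real.log S.m :=
  Real.log_pos (by exact_mod_cast S.hm)

theorem log_n_pos (S : GDBMCarpet) : 0 < Real.log S.n :=
  Real.log_pos (by exact_mod_cast S.hm.trans S.hmn.le)

theorem GraphIrreducible.exists_coverNum_le [Nonempty S.V] (hirr : S.GraphIrreducible) {s : ℝ}
    (hs : S.hTopPiI / Real.log S.m + (⨆ y ∈ S.piI, S.hTopFiber y) / Real.log S.n < s) :
    ∃ C : ℝ, 0 < C ∧ ∀ x ∈ S.Xunion, ∀ r R : ℝ, 0 < r → r < R → R ≤ 1 →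
      (coverNum r (S.Xunion ∩ ball x R) : ℝ) ≤ C * (R / r) ^ s := by
  obtain ⟨C₂, hC₂, hfib⟩ := hirr.exists_card_fiberXk_le
  set F := ⨆ y ∈ S.piI, S.hTopFiber y
  have hF : 0 ≤ F := iSup_hTopFiber_nonneg
  have hlm := S.log_m_pos
  have hln := S.log_n_pos
  set u := s - F / Real.log S.n
  set w := F / Real.log S.n
  have hu : S.hTopPiI / Real.log S.m < u := by simp only [u]; linarith
  have hu0 : 0 ≤ u := (div_nonneg hTopPiI_nonneg hlm.le).trans hu.le
  have hw0 : 0 ≤ w := div_nonneg hF hln.le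
  obtain ⟨C₁, hC₁, hP⟩ := exists_le_mul_exp_of_limsup_lt (c := fun k => (S.piIk k).card)
    S.m_pos card_piIk_le ((div_lt_iff₀ hlm).1 hu)
  have hm0 : (0 : ℝ) < S.m := by exact_mod_cast S.m_pos
  have hn0 : (0 : ℝ) < S.n := by exact_mod_cast S.n_pos
  have hn1 : (1 : ℝ) < S.n := by exact_mod_cast S.hm.trans S.hmn.le
  have hmn : (S.m : ℝ) ≤ S.n := by exact_mod_cast S.hmn.le
  refine ⟨25 * (C₁ * ((S.m : ℝ) ^ 2) ^ u * (C₂ * ((S.n : ℝ) ^ 2) ^ w)), by positivity,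
    fun x _ r R hr hrR hR => ?_⟩
  have hρ : 0 < R / r := div_pos (hr.trans hrR) hr
  obtain ⟨L, l, hLl, hRL, hrl, hrl', hnl⟩ :=
    exists_levels (lt_of_lt_of_le one_lt_two (S.hm.trans S.hmn.le)) hr hrR hR
  obtain ⟨K, k, hKk, hRK, hrk, hrk', hmk⟩ :=
    exists_levels (lt_of_lt_of_le one_lt_two S.hm) hr hrR hR
  have hlk : l < k + 1 := by
    rw [← pow_lt_pow_iff_right₀ hn1]
    have h1 : r * (S.n : ℝ) ^ l < r * (S.m : ℝ) ^ (k + 1) := hrl.trans_lt hrk'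
    exact (lt_of_mul_lt_mul_left h1 hr.le).trans_le (pow_le_pow_left₀ hm0.le hmn _)
  have hcov := coverNum_le (x := x) (k := k + 1) (M := ⌊C₂ * Real.exp (F * (l + 1 - L : ℕ))⌋₊)
    hRL hRK ((div_le_iff₀ (by positivity)).2 hrl'.le) ((div_le_iff₀ (by positivity)).2 hrk'.le)
    hLl (by omega) hKk fun y => Nat.le_floor (hfib y _)
  have hFw : F = w * Real.log S.n := (div_mul_cancel₀ _ hln.ne').symm
  have hsum : u + w = s := by simp only [u, w]; ring
  calc (coverNum r (S.Xunion ∩ ball x R) : ℝ)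
      ≤ 25 * ((S.piIk (k + 1 - K)).card * ⌊C₂ * Real.exp (F * (l + 1 - L : ℕ))⌋₊) := by
        exact_mod_cast hcov
    _ ≤ 25 * ((C₁ * Real.exp (u * Real.log S.m * (k + 1 - K : ℕ))) *
          (C₂ * Real.exp (F * (l + 1 - L : ℕ)))) := by
        gcongr
        · exact hP _
        · exact Nat.floor_le (by positivity)
    _ ≤ 25 * ((C₁ * (((S.m : ℝ) ^ 2) ^ u * (R / r) ^ u)) *
          (C₂ * (((S.n : ℝ) ^ 2) ^ w * (R / r) ^ w))) := by
        gcongr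
        · exact exp_mul_log_mul_le S.m_pos hu0 hρ.le hmk
        · rw [hFw]
          exact exp_mul_log_mul_le S.n_pos hw0 hρ.le hnl
    _ = 25 * (C₁ * ((S.m : ℝ) ^ 2) ^ u * (C₂ * ((S.n : ℝ) ^ 2) ^ w)) * (R / r) ^ s := by
        rw [← hsum, Real.rpow_add hρ]
        ring

theorem exists_pow_add_le (S : GDBMCarpet) (j : ℕ) : ∃ L, 0 < L ∧ S.m ^ (L + j) ≤ S.n ^ L := by
  have hm0 : (0 : ℝ) < S.m := by exact_mod_cast S.m_pos
  have hm1 : (1 : ℝ) ≤ S.m := by exact_mod_cast S.m_pos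
  obtain ⟨L, hL⟩ := pow_unbounded_of_one_lt ((S.m : ℝ) ^ j)
    ((one_lt_div hm0).2 (by exact_mod_cast S.hmn : (S.m : ℝ) < S.n))
  refine ⟨L, Nat.pos_of_ne_zero ?_, ?_⟩
  · rintro rfl
    rw [pow_zero] at hL
    exact absurd (one_le_pow₀ hm1) (not_le.2 hL)
  · rw [div_pow, lt_div_iff₀ (by positivity)] at hL
    rw [add_comm, pow_add]
    exact_mod_cast hL.le

theorem GraphIrreducible.exists_card_fiberXk_mul_le [Nonempty S.V] (hirr : S.GraphIrreducible)
    {s C : ℝ} (hs : 0 ≤ s) (hC : 0 < C)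
    (h : ∀ x ∈ S.Xunion, ∀ r R : ℝ, 0 < r → r < R → R ≤ 1 →
      (coverNum r (S.Xunion ∩ ball x R) : ℝ) ≤ C * (R / r) ^ s) :
    ∃ C' : ℝ, 0 < C' ∧ ∀ (y : ℕ → Fin S.m) (j : ℕ),
      ((S.fiberXk y j).card : ℝ) * (S.piIk (Nat.log S.m (S.n ^ j))).card ≤
        C' * ((S.n : ℝ) ^ j) ^ s := by
  obtain ⟨B, hB⟩ := hirr.card_mul_card_le_coverNum
  have hV : (0 : ℝ) < Fintype.card S.V := by exact_mod_cast Fintype.card_pos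
  have hm0 : (0 : ℝ) < S.m := by exact_mod_cast S.m_pos
  have hm1 : (1 : ℝ) ≤ S.m := by exact_mod_cast S.m_pos
  have hm2 : (2 : ℝ) ≤ S.m := by exact_mod_cast S.hm
  have hn0 : (0 : ℝ) < S.n := by exact_mod_cast S.n_pos
  have hm1' : 1 < S.m := lt_of_lt_of_le one_lt_two S.hm
  refine ⟨25 * Fintype.card S.V ^ 3 * (C * (2 * (S.m : ℝ) ^ (B + 2)) ^ s), by positivity,
    fun y j => ?_⟩
  set t := Nat.log S.m (S.n ^ j)
  obtain ⟨L, hL0, hL⟩ := S.exists_pow_add_le j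
  set K := Nat.log S.m (S.n ^ L)
  have hnL : S.n ^ L ≠ 0 := (pow_pos S.n_pos L).ne'
  have hnj : S.n ^ j ≠ 0 := (pow_pos S.n_pos j).ne'
  have hLK : L + j ≤ K := Nat.le_log_of_pow_le hm1' hL
  have hK : (S.m : ℝ) ^ K ≤ (S.n : ℝ) ^ L := by exact_mod_cast Nat.pow_log_le_self S.m hnL
  have ht : (S.m : ℝ) ^ t ≤ (S.n : ℝ) ^ j := by exact_mod_cast Nat.pow_log_le_self S.m hnj
  have hK' : (S.n : ℝ) ^ L ≤ (S.m : ℝ) ^ (K + 1) := by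
    exact_mod_cast (Nat.lt_pow_succ_log_self hm1' (S.n ^ L)).le
  have ht' : (S.n : ℝ) ^ j ≤ (S.m : ℝ) ^ (t + 1) := by
    exact_mod_cast (Nat.lt_pow_succ_log_self hm1' (S.n ^ j)).le
  have hKpos : (0 : ℝ) < (S.m : ℝ) ^ K := by positivity
  have hmKR : 1 / (S.m : ℝ) ^ K < 2 / (S.m : ℝ) ^ K := by gcongr; norm_num
  have hrle : 1 / (S.m : ℝ) ^ (K + B + t + 2) ≤ 1 / (S.m : ℝ) ^ K :=
    one_div_le_one_div_of_le hKpos (pow_le_pow_right₀ hm1 (by omega))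
  obtain ⟨x, hx, hle⟩ := hB y j t L K (1 / (S.m : ℝ) ^ (K + B + t + 2)) (2 / (S.m : ℝ) ^ K) hLK
    ((one_div_le_one_div_of_le hKpos hK).trans_lt hmKR) hmKR (by positivity)
    (by
      rw [div_mul_eq_mul_div, one_mul, div_le_one (by positivity), pow_add]
      calc (S.n : ℝ) ^ L * (S.n : ℝ) ^ j ≤ (S.m : ℝ) ^ (K + 1) * (S.m : ℝ) ^ (t + 1) := by gcongr
        _ = (S.m : ℝ) ^ (K + 1 + (t + 1)) := (pow_add _ _ _).symm
        _ ≤ _ := pow_le_pow_right₀ hm1 (by omega))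
    (by
      rw [div_mul_eq_mul_div, one_mul, div_le_one (by positivity)]
      exact pow_le_pow_right₀ hm1 (by omega))
  have hcov := h x hx _ _ (by positivity) (hrle.trans_lt hmKR) (by
    rw [div_le_one hKpos]
    exact hm2.trans (le_self_pow₀ hm1 (by omega)))
  have hquot : 2 / (S.m : ℝ) ^ K / (1 / (S.m : ℝ) ^ (K + B + t + 2)) =
      2 * (S.m : ℝ) ^ (B + 2) * (S.m : ℝ) ^ t := by
    rw [div_div_eq_mul_div, div_one, div_mul_eq_mul_div, div_eq_iff hKpos.ne']
    ring
  rw [hquot, Real.mul_rpow (by positivity) (by positivity)] at hcov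
  calc ((S.fiberXk y j).card : ℝ) * (S.piIk t).card
      ≤ 25 * Fintype.card S.V ^ 3 * coverNum (1 / (S.m : ℝ) ^ (K + B + t + 2))
          (S.Xunion ∩ ball x (2 / (S.m : ℝ) ^ K)) := by exact_mod_cast hle
    _ ≤ 25 * Fintype.card S.V ^ 3 *
          (C * ((2 * (S.m : ℝ) ^ (B + 2)) ^ s * ((S.m : ℝ) ^ t) ^ s)) := by gcongr
    _ ≤ 25 * Fintype.card S.V ^ 3 *
          (C * ((2 * (S.m : ℝ) ^ (B + 2)) ^ s * ((S.n : ℝ) ^ j) ^ s)) := by gcongr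
    _ = _ := by ring

theorem GraphIrreducible.entropy_le [Nonempty S.V] (hirr : S.GraphIrreducible)
    {s C : ℝ} (hs : 0 ≤ s) (hC : 0 < C)
    (h : ∀ x ∈ S.Xunion, ∀ r R : ℝ, 0 < r → r < R → R ≤ 1 →
      (coverNum r (S.Xunion ∩ ball x R) : ℝ) ≤ C * (R / r) ^ s) :
    S.hTopPiI / Real.log S.m + (⨆ y ∈ S.piI, S.hTopFiber y) / Real.log S.n ≤ s := by
  obtain ⟨C', hC', hle⟩ := hirr.exists_card_fiberXk_mul_le hs hC h
  have hlm := S.log_m_pos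
  have hln := S.log_n_pos
  set H := S.hTopPiI
  have hH : 0 ≤ H := hTopPiI_nonneg
  have key : ∀ y ∈ S.piI, S.hTopFiber y ≤ (s - H / Real.log S.m) * Real.log S.n := by
    rintro y ⟨ω, hω, hy⟩
    have hpos (k : ℕ) : 0 < (S.fiberXk y k).card := by
      refine Finset.card_pos.2 ⟨xs k ω, ?_⟩
      rw [← Finset.mem_coe, coe_fiberXk]
      exact ⟨ω, ⟨hω, fun i _ => hy i⟩, rfl⟩
    refine limsup_log_card_div_le_of_le_mul_exp (C := C' * Real.exp H) hpos fun j => ?_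
    set t := Nat.log S.m (S.n ^ j)
    have hn0 : (0 : ℝ) < S.n := by exact_mod_cast S.n_pos
    have ht : (S.n : ℝ) ^ j ≤ (S.m : ℝ) ^ (t + 1) := by
      exact_mod_cast
        (Nat.lt_pow_succ_log_self (lt_of_lt_of_le one_lt_two S.hm) (S.n ^ j)).le
    have ht' := Real.log_le_log (by positivity) ht
    rw [Real.log_pow, Real.log_pow, ← div_le_iff₀ hlm] at ht'
    have hP : Real.exp (H * (j * Real.log S.n / Real.log S.m)) * Real.exp (-H) ≤
        (S.piIk t).card := by
      refine le_trans ?_ (exp_hTopPiI_le_card t)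
      rw [← Real.exp_add, Real.exp_le_exp]
      have := mul_le_mul_of_nonneg_left ht' hH
      push_cast at this
      linarith
    have hmain := (mul_le_mul_of_nonneg_left hP (Nat.cast_nonneg (S.fiberXk y j).card)).trans
      (hle y j)
    rw [Real.rpow_def_of_pos (by positivity), Real.log_pow] at hmain
    have hE : Real.exp ((s - H / Real.log S.m) * Real.log S.n * j) *
        Real.exp (H * (j * Real.log S.n / Real.log S.m)) = Real.exp (j * Real.log S.n * s) := by
      rw [← Real.exp_add]
      congr 1
      ring
    rw [← hE, Real.exp_neg, ← mul_assoc, ← div_eq_mul_inv, div_le_iff₀ (Real.exp_pos _)] at hmain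
    refine le_of_mul_le_mul_right (hmain.trans_eq ?_) (Real.exp_pos _)
    ring
  obtain ⟨ω, hω, -⟩ := exists_path_from (Classical.arbitrary S.V)
  have hnonneg : 0 ≤ (s - H / Real.log S.m) * Real.log S.n :=
    (hTopFiber_nonneg _).trans (key (fun i => S.yd (ω i)) ⟨ω, hω, fun _ => rfl⟩)
  have hsup : (⨆ y ∈ S.piI, S.hTopFiber y) ≤ (s - H / Real.log S.m) * Real.log S.n :=
    Real.iSup_le (fun y => Real.iSup_le (key y) hnonneg) hnonneg
  rw [← div_le_iff₀ hln] at hsup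
  linarith

theorem entropy_eq_zero_of_isEmpty [IsEmpty S.V] :
    S.hTopPiI = 0 ∧ (⨆ y ∈ S.piI, S.hTopFiber y) = 0 := by
  have : IsEmpty S.E := ⟨fun e => isEmptyElim (S.src e)⟩
  have hpiI : S.piI = ∅ := eq_empty_of_forall_notMem fun _ ⟨ω, _⟩ => isEmptyElim (ω 0)
  have hpiIk : ∀ k, Real.log (S.piIk k).card / (k : ℝ) = 0 := by
    rintro (_ | k)
    · simp
    · have : S.piIk (k + 1) = ∅ := by
        simp only [piIk, Finset.filter_eq_empty_iff]
        rintro y - ⟨w, -⟩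
        exact isEmptyElim (w 0)
      simp [this]
  constructor
  · simp only [hTopPiI, hpiIk, limsup_const]
  · simp [hpiI]

theorem assouadDim_of_isEmpty [IsEmpty S.V] : assouadDim S.Xunion = 0 := by
  have hX : S.Xunion = ∅ := iUnion_of_empty _
  refine le_antisymm (csInf_le ⟨0, fun _ h => h.1⟩ ⟨le_rfl, 1, one_pos, ?_⟩)
    (Real.sInf_nonneg fun _ h => h.1)
  simp [hX]

end GDBMCarpet

/-- **Theorem 5.1 / Lemma 5.2.** If `G` is irreducible, then
`dim_A X = h_top(πI)/log m + sup_{y∈πI} h_top(π⁻¹(y))/log n`. -/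
theorem assouadDim_irreducible_entropy (S : GDBMCarpet)
    (hirr : S.GraphIrreducible) :
    assouadDim S.Xunion =
      S.hTopPiI / Real.log S.m + (⨆ y ∈ S.piI, S.hTopFiber y) / Real.log S.n := by
  rcases isEmpty_or_nonempty S.V with hV | hV
  · obtain ⟨h1, h2⟩ := GDBMCarpet.entropy_eq_zero_of_isEmpty (S := S)
    rw [GDBMCarpet.assouadDim_of_isEmpty, h1, h2]
    simp
  have hnonneg :
      0 ≤ S.hTopPiI / Real.log S.m + (⨆ y ∈ S.piI, S.hTopFiber y) / Real.log S.n :=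
    add_nonneg (div_nonneg GDBMCarpet.hTopPiI_nonneg S.log_m_pos.le)
      (div_nonneg GDBMCarpet.iSup_hTopFiber_nonneg S.log_n_pos.le)
  refine le_antisymm (le_of_forall_gt_imp_ge_of_dense fun s hs =>
    csInf_le ⟨0, fun _ h => h.1⟩ ⟨hnonneg.trans hs.le, hirr.exists_coverNum_le hs⟩)
    (le_csInf ⟨_, hnonneg.trans (lt_add_one _).le, hirr.exists_coverNum_le (lt_add_one _)⟩ ?_)
  rintro s ⟨hs, C, hC, h⟩
  exact hirr.entropy_le hs hC h
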